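/- arXiv:1409.0063 — 11 statements merged into one kernel-verified Lean document; each statement's English description precedes it below -/
import Mathlib

section
/- For every positive integer n, the polynomial f_n(x,y) = (n/2)x² + (1 − n/2)x + y is a packing polynomial on the sector S(n), i.e. its restriction to the lattice points of S(n) is a bijection onto ℕ. -/
/-- The set of lattice points `I(n/m)` of the sector
`S(n/m) = {(x,y) : x ≥ 0, y ≥ 0, y ≤ (n/m)·x}`, described by `m·y ≤ n·x`. -/
def sectorLattice (n m : ℤ) : Set (ℤ × ℤ) :=
  {P : ℤ × ℤ | 0 ≤ P.1 ∧ 0 ≤ P.2 ∧ m * P.2 ≤ n * P.1}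

/-- The sector `S(n/m)` in the real plane. -/
def sectorR (n m : ℤ) : Set (ℝ × ℝ) :=
  {P : ℝ × ℝ | 0 ≤ P.1 ∧ 0 ≤ P.2 ∧ (m : ℝ) * P.2 ≤ (n : ℝ) * P.1}

/-- `p` is a packing polynomial on the region whose lattice points are `I`:
the restriction of `p` to `I` is a bijection from `I` onto `ℕ`. -/
def IsPackingPolyOn (p : ℝ → ℝ → ℝ) (I : Set (ℤ × ℤ)) : Prop :=
  (∀ P ∈ I, ∃ j : ℕ, p P.1 P.2 = j) ∧
  Set.InjOn (fun P : ℤ × ℤ => p P.1 P.2) I ∧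
  (∀ j : ℕ, ∃ P ∈ I, p P.1 P.2 = j)

/-- The `c`-th staircase `S_c` of `I(n/m)`: lattice points of the sector on the line
`y = (n/(m−1))·x − c·l/(m−1)`, i.e. `(m−1)·y = n·x − c·l`, where `l = gcd(n, m−1)`. -/
def staircase (n m : ℤ) (c : ℕ) : Set (ℤ × ℤ) :=
  {P : ℤ × ℤ | P ∈ sectorLattice n m ∧
    (m - 1) * P.2 = n * P.1 - (c : ℤ) * (Int.gcd n (m - 1) : ℤ)}

/-- Two stairs `r`, `s` are consecutive: they lie on a common staircase, are distinct,
and no stair of that staircase lies strictly between them on the segment from `r` to `s`. -/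
def ConsecutiveStairs (n m : ℤ) (r s : ℤ × ℤ) : Prop :=
  ∃ c : ℕ, r ∈ staircase n m c ∧ s ∈ staircase n m c ∧ r ≠ s ∧
    ∀ t ∈ staircase n m c, ¬(min r.1 s.1 < t.1 ∧ t.1 < max r.1 s.1)

/-- `P` is the first stair on the `c`-th staircase: the stair with minimal `x`-coordinate. -/
def IsFirstStair (n m : ℤ) (c : ℕ) (P : ℤ × ℤ) : Prop :=
  P ∈ staircase n m c ∧ ∀ Q ∈ staircase n m c, P.1 ≤ Q.1

/-- `p` is a quadratic polynomial whose homogeneous quadratic part is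
`(n/2)·(x − ((m−1)/n)·y)²`. -/
def HasQuadPart (n m : ℤ) (p : ℝ → ℝ → ℝ) : Prop :=
  ∃ d e f : ℝ, ∀ x y : ℝ,
    p x y = (n : ℝ) / 2 * (x - ((m : ℝ) - 1) / (n : ℝ) * y) ^ 2 + d * x + e * y + f

/-- `p(ℤ²) ⊆ ℤ`. -/
def IntValued (p : ℝ → ℝ → ℝ) : Prop :=
  ∀ a b : ℤ, ∃ z : ℤ, p a b = z

/-- `p` is a `k`-stair polynomial on `S(n/m)`: a quadratic polynomial with quadratic part
`(n/2)(x − ((m−1)/n)y)²`, integer-valued on `ℤ²`, whose values at consecutive stairs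
differ by `±k`. -/
def IsKStair (n m : ℤ) (k : ℕ) (p : ℝ → ℝ → ℝ) : Prop :=
  HasQuadPart n m p ∧ IntValued p ∧
  ∀ r s : ℤ × ℤ, ConsecutiveStairs n m r s →
    p r.1 r.2 - p s.1 s.2 = (k : ℝ) ∨ p r.1 r.2 - p s.1 s.2 = -(k : ℝ)

/-- An ascending `k`-stair polynomial: for consecutive stairs `r`, `s` with `|r| < |s|`,
`p(s) − p(r) = k`. -/
def IsAscendingKStair (n m : ℤ) (k : ℕ) (p : ℝ → ℝ → ℝ) : Prop :=
  IsKStair n m k p ∧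
  ∀ r s : ℤ × ℤ, ConsecutiveStairs n m r s →
    r.1 ^ 2 + r.2 ^ 2 < s.1 ^ 2 + s.2 ^ 2 → p s.1 s.2 - p r.1 r.2 = (k : ℝ)

/-- A descending `k`-stair polynomial: for consecutive stairs `r`, `s` with `|r| < |s|`,
`p(s) − p(r) = −k`. -/
def IsDescendingKStair (n m : ℤ) (k : ℕ) (p : ℝ → ℝ → ℝ) : Prop :=
  IsKStair n m k p ∧
  ∀ r s : ℤ × ℤ, ConsecutiveStairs n m r s →
    r.1 ^ 2 + r.2 ^ 2 < s.1 ^ 2 + s.2 ^ 2 → p s.1 s.2 - p r.1 r.2 = -(k : ℝ)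

theorem nathanson_aux_lt (n : ℕ) (a b c d : ℤ) (ha : 0 ≤ a) (hb : b ≤ n * a) (hd : 0 ≤ d)
    (h : a < c) :
    (n : ℝ) / 2 * (a : ℝ) ^ 2 + (1 - (n : ℝ) / 2) * a + b
      < (n : ℝ) / 2 * (c : ℝ) ^ 2 + (1 - (n : ℝ) / 2) * c + d := by
  have ha' : (0 : ℝ) ≤ a := by exact_mod_cast ha
  have hb' : (b : ℝ) ≤ n * a := by exact_mod_cast hb
  have hd' : (0 : ℝ) ≤ d := by exact_mod_cast hd
  have h' : (a : ℝ) + 1 ≤ c := by exact_mod_cast h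
  have hn : (0 : ℝ) ≤ n := Nat.cast_nonneg n
  have key : (0 : ℝ) ≤ n * ((c + a) * (c - a - 1)) :=
    mul_nonneg hn (mul_nonneg (by linarith) (by linarith))
  nlinarith

/-- For every positive integer `n`, the polynomial
`f_n(x,y) = (n/2)x² + (1 − n/2)x + y` is a packing polynomial on the sector `S(n)`. -/
theorem nathanson_f_packing (n : ℕ) (hn : 0 < n) :
    IsPackingPolyOn
      (fun x y : ℝ => (n : ℝ) / 2 * x ^ 2 + (1 - (n : ℝ) / 2) * x + y)
      (sectorLattice (n : ℤ) 1) := by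
  refine ⟨?_, ?_, ?_⟩
  · rintro ⟨a, b⟩ ⟨ha, hb, -⟩
    simp only at ha hb ⊢
    lift a to ℕ using ha
    lift b to ℕ using hb
    refine ⟨n * a.choose 2 + a + b, ?_⟩
    push_cast [Nat.cast_choose_two]
    ring
  · rintro ⟨a, b⟩ ⟨ha, hb, hab⟩ ⟨c, d⟩ ⟨hc, hd, hcd⟩ h
    simp only [one_mul] at ha hb hab hc hd hcd h
    rcases lt_trichotomy a c with hlt | heq | hgt
    · exact absurd h (nathanson_aux_lt n a b c d ha hab hd hlt).ne
    · subst heq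
      have : (b : ℝ) = d := by linarith
      have : b = d := by exact_mod_cast this
      rw [this]
    · exact absurd h (nathanson_aux_lt n c d a b hc hcd hb hgt).ne'
  · intro j
    induction j with
    | zero => exact ⟨(0, 0), by simp [sectorLattice], by simp⟩
    | succ j ih =>
      obtain ⟨⟨a, b⟩, ⟨ha, hb, hab⟩, h⟩ := ih
      simp only [one_mul] at ha hb hab h
      rcases hab.lt_or_eq with hlt | heq
      · refine ⟨(a, b + 1), ⟨ha, by simp only; omega, by simp only; omega⟩, ?_⟩
        push_cast
        linarith
      · refine ⟨(a + 1, 0), ⟨by simp only; omega, le_refl _, ?_⟩, ?_⟩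
        · simp only [mul_zero]
          positivity
        · have hb' : (b : ℝ) = n * a := by exact_mod_cast heq
          rw [hb'] at h
          push_cast
          linarith
end

section
/- For every positive integer n, the polynomial g_n(x,y) = (n/2)x² + (1 + n/2)x − y is a packing polynomial on the sector S(n), i.e. its restriction to the lattice points of S(n) is a bijection onto ℕ. -/
/-- For every positive integer `n`, the polynomial
`g_n(x,y) = (n/2)x² + (1 + n/2)x − y` is a packing polynomial on the sector `S(n)`. -/
theorem nathanson_g_packing (n : ℕ) (hn : 0 < n) :
    IsPackingPolyOn
      (fun x y : ℝ => (n : ℝ) / 2 * x ^ 2 + (1 + (n : ℝ) / 2) * x - y)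
      (sectorLattice (n : ℤ) 1) := by
  have hn' : (1 : ℝ) ≤ n := by exact_mod_cast hn
  refine ⟨?_, ?_, ?_⟩
  · rintro ⟨x, y⟩ ⟨hx, hy, hxy⟩
    simp only [one_mul] at hx hy hxy
    obtain ⟨k, hk⟩ := Int.even_mul_succ_self x
    have hz : 0 ≤ n * k + x - y := by
      have h1 : x ≤ k ∨ x * x < x + 1 := by
        by_cases h : x ≤ k
        · exact Or.inl h
        · right; nlinarith
      rcases h1 with h1 | h1
      · nlinarith
      · have : x ≤ 1 := by nlinarith
        have h2 : x = 0 ∨ x = 1 := by omega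
        rcases h2 with rfl | rfl
        · have : k = 0 := by omega
          subst this; simp at hxy ⊢; omega
        · have : k = 1 := by omega
          subst this; simp at hxy ⊢; omega
    refine ⟨(n * k + x - y).toNat, ?_⟩
    have e : (((n * k + x - y).toNat : ℤ) : ℝ) = ((n * k + x - y : ℤ) : ℝ) := by
      rw [Int.toNat_of_nonneg hz]
    have hk' : (x : ℝ) * (x + 1) = k + k := by exact_mod_cast hk
    rw [Int.cast_natCast] at e
    rw [e]
    push_cast
    linear_combination (n : ℝ) / 2 * hk'
  · have key : ∀ x y x' y' : ℤ, 0 ≤ x → 0 ≤ y → y' ≤ n * x' → x < x' →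
        (n : ℝ) / 2 * (x : ℝ) ^ 2 + (1 + (n : ℝ) / 2) * x - y <
        (n : ℝ) / 2 * (x' : ℝ) ^ 2 + (1 + (n : ℝ) / 2) * x' - y' := by
      intro x y x' y' hx hy hy' hlt
      have a1 : (0 : ℝ) ≤ x := by exact_mod_cast hx
      have a2 : (0 : ℝ) ≤ y := by exact_mod_cast hy
      have a3 : (y' : ℝ) ≤ n * x' := by exact_mod_cast hy'
      have a4 : (x : ℝ) + 1 ≤ x' := by exact_mod_cast hlt
      have a5 : (x : ℝ) * (x + 1) ≤ x' * (x' - 1) := by nlinarith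
      have a6 := mul_le_mul_of_nonneg_left a5 (by positivity : (0 : ℝ) ≤ (n : ℝ) / 2)
      linarith
    rintro ⟨x, y⟩ ⟨hx, hy, hxy⟩ ⟨x', y'⟩ ⟨hx', hy', hxy'⟩ h
    simp only [one_mul] at hx hy hxy hx' hy' hxy' h
    rcases lt_trichotomy x x' with hlt | rfl | hlt
    · exact absurd h (key x y x' y' hx hy hxy' hlt).ne
    · have : (y : ℝ) = y' := by linarith
      have : y = y' := by exact_mod_cast this
      rw [this]
    · exact absurd h (key x' y' x y hx' hy' hxy hlt).ne'
  · intro j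
    induction j with
    | zero => exact ⟨(0, 0), by simp [sectorLattice], by simp⟩
    | succ j ih =>
      obtain ⟨⟨x, y⟩, ⟨hx, hy, hxy⟩, h⟩ := ih
      simp only [one_mul] at hx hy hxy h
      by_cases h0 : y = 0
      · subst h0
        refine ⟨(x + 1, n * (x + 1)), ⟨?_, ?_, ?_⟩, ?_⟩
        · show 0 ≤ x + 1
          omega
        · show 0 ≤ (n : ℤ) * (x + 1)
          positivity
        · simp
        · push_cast at h ⊢
          linear_combination h
      · refine ⟨(x, y - 1), ⟨hx, ?_, ?_⟩, ?_⟩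
        · show 0 ≤ y - 1
          omega
        · show 1 * (y - 1) ≤ n * x
          omega
        · push_cast
          linear_combination h
end

section
/- Let n and m be coprime positive integers. The linear map W_{n/m} given by the matrix with rows (1, −⌊m/n⌋) and (0, 1), i.e. (x,y) ↦ (x − ⌊m/n⌋·y, y), restricts to a bijection from I(n/m) to I(n/(m − n·⌊m/n⌋)). -/
/-- For coprime positive integers `n`, `m`, the map
`W_{n/m} : (x,y) ↦ (x − ⌊m/n⌋·y, y)` restricts to a bijection from `I(n/m)` to
`I(n/(m − n·⌊m/n⌋))`. -/
theorem W_bijection (n m : ℕ) (hn : 0 < n) (hm : 0 < m) (hco : Nat.Coprime n m) :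
    Set.BijOn (fun P : ℤ × ℤ => (P.1 - ((m / n : ℕ) : ℤ) * P.2, P.2))
      (sectorLattice (n : ℤ) (m : ℤ))
      (sectorLattice (n : ℤ) ((m : ℤ) - (n : ℤ) * ((m / n : ℕ) : ℤ))) := by
  have hq : (n : ℤ) * ((m / n : ℕ) : ℤ) ≤ (m : ℤ) := by
    exact_mod_cast Nat.mul_div_le m n
  have hq0 : (0 : ℤ) ≤ ((m / n : ℕ) : ℤ) := Int.natCast_nonneg _
  have hn' : (0 : ℤ) < (n : ℤ) := by exact_mod_cast hn
  generalize ((m / n : ℕ) : ℤ) = q at hq hq0 ⊢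
  refine ⟨?_, ?_, ?_⟩
  · rintro ⟨x, y⟩ ⟨hx, hy, h⟩
    dsimp only at hx hy h
    refine ⟨?_, hy, ?_⟩
    · have h1 : (n : ℤ) * q * y ≤ m * y := mul_le_mul_of_nonneg_right hq hy
      have h2 : 0 ≤ (n : ℤ) * (x - q * y) := by linarith
      exact nonneg_of_mul_nonneg_right h2 hn'
    · dsimp only
      linarith
  · rintro ⟨x, y⟩ _ ⟨x', y'⟩ _ h
    simp only [Prod.mk.injEq] at h
    obtain ⟨h1, rfl⟩ := h
    simp only [Prod.mk.injEq, and_true]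
    linarith
  · rintro ⟨x, y⟩ ⟨hx, hy, h⟩
    dsimp only at hx hy h
    refine ⟨(x + q * y, y), ⟨?_, hy, ?_⟩, ?_⟩
    · dsimp only
      positivity
    · dsimp only
      linarith
    · simp
end

section
/- Let m, n be coprime positive integers with m ≥ 2 and n dividing (m−1)², and set l = gcd(n, m−1). Then I(n/m) = ⋃_{c ∈ ℕ} S_c, i.e. every lattice point of the sector S(n/m) lies on some staircase S_c with c ∈ ℕ. -/
/-- For coprime positive integers `n`, `m` with `m ≥ 2` and `n ∣ (m−1)²`,
every lattice point of the sector `S(n/m)` lies on some staircase `S_c`, `c ∈ ℕ`: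
`I(n/m) = ⋃_{c ∈ ℕ} S_c`. -/
theorem sector_eq_iUnion_staircases (n m : ℕ) (hn : 0 < n) (hm : 2 ≤ m)
    (hco : Nat.Coprime n m) (hdvd : n ∣ (m - 1) ^ 2) :
    sectorLattice (n : ℤ) (m : ℤ) = ⋃ c : ℕ, staircase (n : ℤ) (m : ℤ) c := by
  ext P
  simp only [Set.mem_iUnion]
  constructor
  · intro hP
    obtain ⟨h1, h2, h3⟩ := id hP
    have hl : ((Int.gcd (n : ℤ) ((m : ℤ) - 1) : ℕ) : ℤ) ∣ (n : ℤ) * P.1 - ((m : ℤ) - 1) * P.2 :=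
      dvd_sub (Dvd.dvd.mul_right (Int.gcd_dvd_left _ _) _)
        (Dvd.dvd.mul_right (Int.gcd_dvd_right _ _) _)
    obtain ⟨k, hk⟩ := hl
    have hpos : (0 : ℤ) < ((Int.gcd (n : ℤ) ((m : ℤ) - 1) : ℕ) : ℤ) := by
      have : 0 < Int.gcd (n : ℤ) ((m : ℤ) - 1) := Int.gcd_pos_of_ne_zero_left _ (by omega)
      exact_mod_cast this
    have hk0 : 0 ≤ k := by
      by_contra hneg
      push Not at hneg
      nlinarith
    refine ⟨k.toNat, hP, ?_⟩
    rw [Int.toNat_of_nonneg hk0]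
    linarith
  · rintro ⟨c, hc⟩
    exact hc.1
end

section
/- Let m, n be coprime positive integers with m ≥ 2 and n dividing (m−1)², and set l = gcd(n, m−1). If p is a quadratic packing polynomial on S(n/m) (so by Stanton's theorem its homogeneous quadratic part is p₂(x,y) = (n/2)(x − ((m−1)/n)y)²), then there exists k ∈ ℕ such that for every (x,y) ∈ S(n/m), p(x + (m−1)/l, y + n/l) − p(x,y) = k or p(x + (m−1)/l, y + n/l) − p(x,y) = −k. -/
/-- If `p` is a quadratic packing polynomial on `S(n/m)` with homogeneous
quadratic part `(n/2)(x − ((m−1)/n)y)²`, then there is `k ∈ ℕ` such that for every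
`(x,y) ∈ S(n/m)`, `p(x + (m−1)/l, y + n/l) − p(x,y) = ±k`, where `l = gcd(n, m−1)`. -/
theorem kstair_translation (n m : ℕ) (hn : 0 < n) (hm : 2 ≤ m)
    (hco : Nat.Coprime n m) (hdvd : n ∣ (m - 1) ^ 2)
    (p : ℝ → ℝ → ℝ) (hquad : HasQuadPart (n : ℤ) (m : ℤ) p)
    (hpack : IsPackingPolyOn p (sectorLattice (n : ℤ) (m : ℤ))) :
    ∃ k : ℕ, ∀ x y : ℝ, (x, y) ∈ sectorR (n : ℤ) (m : ℤ) →
      p (x + ((m : ℝ) - 1) / (Nat.gcd n (m - 1) : ℝ))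
          (y + (n : ℝ) / (Nat.gcd n (m - 1) : ℝ)) - p x y = (k : ℝ) ∨
      p (x + ((m : ℝ) - 1) / (Nat.gcd n (m - 1) : ℝ))
          (y + (n : ℝ) / (Nat.gcd n (m - 1) : ℝ)) - p x y = -(k : ℝ) := by
  obtain ⟨d, e, f, hp⟩ := hquad
  obtain ⟨hval, -, -⟩ := hpack
  set l := Nat.gcd n (m - 1) with hl
  have hlpos : 0 < l := Nat.gcd_pos_of_pos_left _ hn
  obtain ⟨a, ha⟩ : l ∣ n := Nat.gcd_dvd_left _ _
  obtain ⟨b, hb⟩ : l ∣ m - 1 := Nat.gcd_dvd_right _ _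
  have hm' : m = l * b + 1 := by omega
  have hlR : (l : ℝ) ≠ 0 := by positivity
  have hnR : (n : ℝ) ≠ 0 := by positivity
  have hnl : (n : ℝ) / (l : ℝ) = a := by
    rw [div_eq_iff hlR, ha]; push_cast; ring
  have hml : ((m : ℝ) - 1) / (l : ℝ) = b := by
    rw [div_eq_iff hlR, hm']; push_cast; ring
  have hrel : ((m : ℝ) - 1) / (n : ℝ) * a = b := by
    rw [← hnl, ← hml]; field_simp
  have hdiff : ∀ x y : ℝ, p (x + b) (y + a) - p x y = d * b + e * a := by
    intro x y
    rw [hp, hp]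
    have : x + (b : ℝ) - (((m : ℤ) : ℝ) - 1) / ((n : ℤ) : ℝ) * (y + a)
        = x - (((m : ℤ) : ℝ) - 1) / ((n : ℤ) : ℝ) * y := by
      push_cast
      linear_combination -hrel
    rw [this]; ring
  obtain ⟨j₁, h₁⟩ := hval (1, 0) (by simp [sectorLattice])
  obtain ⟨j₂, h₂⟩ := hval (1 + (b : ℤ), 0 + (a : ℤ)) (by
    refine ⟨by positivity, by positivity, ?_⟩
    have hl1 : (1 : ℤ) ≤ l := by exact_mod_cast hlpos
    have e1 : (m : ℤ) = l * b + 1 := by exact_mod_cast hm'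
    have e2 : (n : ℤ) = l * a := by exact_mod_cast ha
    have ha0 : (0 : ℤ) ≤ a := by positivity
    simp only
    rw [e1, e2]
    nlinarith)
  have hc := hdiff 1 0
  push_cast at h₁ h₂
  rw [h₁, h₂] at hc
  refine ⟨((j₂ : ℤ) - j₁).natAbs, fun x y _ => ?_⟩
  rw [hnl, hml, hdiff, ← hc]
  generalize hz : ((j₂ : ℤ) - j₁).natAbs = k
  rcases Int.natAbs_eq ((j₂ : ℤ) - j₁) with h | h
  · left
    rw [hz] at h
    have h' := congrArg (Int.cast : ℤ → ℝ) h
    push_cast at h'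
    exact h'
  · right
    rw [hz] at h
    have h' := congrArg (Int.cast : ℤ → ℝ) h
    push_cast at h'
    exact h'
end

section
/- Let m, n be coprime positive integers with m ≥ 2 and n dividing (m−1)², set l = gcd(n, m−1), and let p be an ascending k-stair packing polynomial on S(n/m) with k ≥ 1. Then there exists j₀ ∈ ℕ such that for all j ≥ j₀, whenever (a,b) ∈ S_j and (a',b') ∈ S_{j+k}, one has p(a,b) ≡ p(a',b') (mod k). -/
lemma quad_force (q k j s α : ℝ) (hq : 1 ≤ q) (hk : 1 ≤ k)
    (hj : 2 * |α| + k + α ^ 2 + k ^ 2 + |α| * k + 2 ≤ j) (hs : -j ≤ s)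
    (hcase : s ≤ -1 ∨ (0 ≤ s ∧ s ≤ k - 1) ∨ k + 1 ≤ s)
    (h1 : q * j * (s - k) + q * s ^ 2 / 2 + α * s ≤ k)
    (h2 : -k ≤ q * j * (s - k) + q * s ^ 2 / 2 + α * s) : False := by
  have hA := abs_nonneg α
  have hA1 := le_abs_self α
  have hA2 := neg_abs_le α
  have hAk : 0 ≤ |α| * k := by positivity
  have hj0 : 0 ≤ j := by nlinarith [sq_nonneg α, sq_nonneg k]
  have hqj : j ≤ q * j := by nlinarith
  rcases hcase with h | ⟨h, h'⟩ | h
  · have e1 : 0 ≤ q * j / 2 + α := by nlinarith [sq_nonneg α, sq_nonneg k]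
    have e2 : s * (q * j / 2 + α) ≤ 0 := mul_nonpos_of_nonpos_of_nonneg (by linarith) e1
    have e3 : 0 ≤ (q * (-s)) * (j + s) := mul_nonneg (mul_nonneg (by linarith) (by linarith)) (by linarith)
    have e4 : k < k * (q * j) := by nlinarith [sq_nonneg α, sq_nonneg k]
    nlinarith
  · have e1 : 0 ≤ (q * j) * (k - 1 - s) := mul_nonneg (by linarith) (by linarith)
    have e2 : s ^ 2 ≤ k ^ 2 := by nlinarith
    have e3 : q * s ^ 2 ≤ q * k ^ 2 := by nlinarith
    have e4 : α * s ≤ |α| * k := by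
      calc α * s ≤ |α| * s := by nlinarith
        _ ≤ |α| * k := by nlinarith
    have e5 : 0 ≤ (q - 1) * (j - k ^ 2 / 2) := mul_nonneg (by linarith) (by nlinarith [sq_nonneg α, sq_nonneg k])
    nlinarith [sq_nonneg α, sq_nonneg k]
  · have e1 : 0 ≤ (q * j) * (s - k - 1) := mul_nonneg (by linarith) (by linarith)
    have e2 : 0 ≤ (q - 1) * s ^ 2 := mul_nonneg (by linarith) (sq_nonneg s)
    nlinarith [sq_nonneg (s + α), sq_nonneg α, sq_nonneg k]

lemma arith_setup (n M : ℕ) (hn : 0 < n) (hM : 0 < M) (hdvd : n ∣ M ^ 2) :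
    ∃ l n' m' q : ℤ, 0 < l ∧ 0 < n' ∧ 0 < m' ∧ 0 < q ∧ (n : ℤ) = l * n' ∧ (M : ℤ) = l * m' ∧
      l = n' * q ∧ IsCoprime n' m' ∧ ((Int.gcd (n : ℤ) (M : ℤ) : ℕ) : ℤ) = l := by
  have hg : 0 < Nat.gcd n M := Nat.gcd_pos_of_pos_left _ hn
  obtain ⟨g, n', m', hg', hco, h1, h2⟩ := Nat.exists_coprime' hg
  have hgl : Nat.gcd n M = g := by
    rw [h1, h2, Nat.gcd_mul_right, hco.gcd_eq_one, one_mul]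
  have hd : n' ∣ g := by
    have : n' * g ∣ (m' ^ 2 * g) * g := by
      have e : (m' ^ 2 * g) * g = M ^ 2 := by rw [h2]; ring
      rw [e, ← h1]; exact hdvd
    have h3 : n' ∣ m' ^ 2 * g := Nat.dvd_of_mul_dvd_mul_right hg' this
    exact (Nat.Coprime.pow_right 2 hco).dvd_of_dvd_mul_left h3
  obtain ⟨q, hq⟩ := hd
  refine ⟨g, n', m', q, by exact_mod_cast hg', ?_, ?_, ?_, ?_, ?_, by exact_mod_cast hq,
    Nat.isCoprime_iff_coprime.mpr hco, ?_⟩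
  · rcases Nat.eq_zero_or_pos n' with h | h
    · subst h; simp at h1; omega
    · exact_mod_cast h
  · rcases Nat.eq_zero_or_pos m' with h | h
    · subst h; simp at h2; omega
    · exact_mod_cast h
  · rcases Nat.eq_zero_or_pos q with h | h
    · subst h; simp at hq; omega
    · exact_mod_cast h
  · rw [h1]; push_cast; ring
  · rw [h2]; push_cast; ring
  · rw [Int.gcd_natCast_natCast, hgl]

set_option maxHeartbeats 1000000 in
/-- If `p` is an ascending `k`-stair packing polynomial on `S(n/m)` (`k ≥ 1`),
then there is `j₀` such that for all `j ≥ j₀`, points of `S_j` and of `S_{j+k}` have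
`p`-values congruent modulo `k`. -/
theorem values_mod_k (n m : ℕ) (hn : 0 < n) (hm : 2 ≤ m)
    (hco : Nat.Coprime n m) (hdvd : n ∣ (m - 1) ^ 2) (k : ℕ) (hk : 1 ≤ k)
    (p : ℝ → ℝ → ℝ) (hstair : IsAscendingKStair (n : ℤ) (m : ℤ) k p)
    (hpack : IsPackingPolyOn p (sectorLattice (n : ℤ) (m : ℤ))) :
    ∃ j₀ : ℕ, ∀ j : ℕ, j₀ ≤ j → ∀ a b a' b' : ℤ,
      (a, b) ∈ staircase (n : ℤ) (m : ℤ) j →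
      (a', b') ∈ staircase (n : ℤ) (m : ℤ) (j + k) →
      ∃ z : ℤ, p a' b' - p a b = (k : ℝ) * z := by
  obtain ⟨M, rfl⟩ : ∃ M, m = M + 1 := ⟨m - 1, by omega⟩
  obtain ⟨l, n', m', q, hl, hn', hm', hq, hnl, hMl, hlq, hcop, hgcd⟩ :=
    arith_setup n M hn (by omega) (by simpa using hdvd)
  have hM1 : (((M + 1 : ℕ) : ℤ)) - 1 = (M : ℤ) := by push_cast; ring
  -- membership descriptions
  have hsec : ∀ x y : ℤ, (x, y) ∈ sectorLattice (n : ℤ) ((M + 1 : ℕ) : ℤ) ↔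
      (0 ≤ x ∧ 0 ≤ y ∧ y ≤ l * (n' * x - m' * y)) := by
    intro x y
    simp only [sectorLattice, Set.mem_ofPred_eq]
    push_cast
    rw [hnl, hMl]
    constructor
    · rintro ⟨h1, h2, h3⟩; exact ⟨h1, h2, by linarith⟩
    · rintro ⟨h1, h2, h3⟩; exact ⟨h1, h2, by linarith⟩
  have hst : ∀ (c : ℕ) (x y : ℤ), (x, y) ∈ staircase (n : ℤ) ((M + 1 : ℕ) : ℤ) c ↔
      ((x, y) ∈ sectorLattice (n : ℤ) ((M + 1 : ℕ) : ℤ) ∧ n' * x - m' * y = c) := by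
    intro c x y
    simp only [staircase, Set.mem_ofPred_eq]
    rw [hM1, hgcd, hnl, hMl]
    constructor
    · rintro ⟨h1, h2⟩
      refine ⟨h1, ?_⟩
      apply mul_left_cancel₀ hl.ne'
      linarith
    · rintro ⟨h1, h2⟩
      refine ⟨h1, ?_⟩
      rw [← h2]; ring
  obtain ⟨⟨⟨d, e, f, hp⟩, -, -⟩, hasc⟩ := hstair
  obtain ⟨hnat, hinj, hsurj⟩ := hpack
  have hn'R : (0 : ℝ) < n' := by exact_mod_cast hn'
  have hqR : (1 : ℝ) ≤ q := by exact_mod_cast hq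
  have hkR : (1 : ℝ) ≤ k := by exact_mod_cast hk
  have hlR : (0 : ℝ) < l := by exact_mod_cast hl
  have hlqR : (l : ℝ) = n' * q := by exact_mod_cast hlq
  have hnR : (n : ℝ) = l * n' := by exact_mod_cast hnl
  have hMR : (M : ℝ) = l * m' := by exact_mod_cast hMl
  have hp' : ∀ x y : ℝ, p x y = q / 2 * (n' * x - m' * y) ^ 2 + d * x + e * y + f := by
    intro x y
    rw [hp]
    push_cast
    rw [hnR, hMR, hlqR]
    have : (q : ℝ) ≠ 0 := by linarith
    field_simp
    ring
  have hstep : d * m' + e * n' = k := by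
    have hl1 : n' ≤ l * n' := by nlinarith
    have h := hasc (1, 0) (1 + m', n') ⟨n'.toNat, ?_, ?_, ?_, ?_⟩ ?_
    · simp only [hp'] at h
      push_cast at h
      linarith
    · rw [hst, hsec]
      refine ⟨⟨by norm_num, le_refl _, ?_⟩, ?_⟩
      · nlinarith
      · rw [Int.toNat_of_nonneg hn'.le]; ring
    · rw [hst, hsec]
      refine ⟨⟨by linarith, hn'.le, ?_⟩, ?_⟩
      · nlinarith
      · rw [Int.toNat_of_nonneg hn'.le]; ring
    · intro h0
      have := congrArg Prod.snd h0
      simp at this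
      omega
    · rintro ⟨t1, t2⟩ ht ⟨h1, h2⟩
      rw [hst, Int.toNat_of_nonneg hn'.le] at ht
      simp only at h1 h2
      rw [min_eq_left (by linarith)] at h1
      rw [max_eq_right (by linarith)] at h2
      have hd : m' ∣ n' * (t1 - 1) := ⟨t2, by linarith [ht.2]⟩
      have hd2 : m' ∣ t1 - 1 := hcop.symm.dvd_of_dvd_mul_left hd
      have := Int.le_of_dvd (by linarith) hd2
      linarith
    · simp only
      nlinarith
  -- translation by a multiple of the step
  have htr : ∀ x y t : ℝ, p (x + t * m') (y + t * n') = p x y + k * t := by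
    intro x y t
    rw [hp', hp', ← hstep]; ring
  have hsame : ∀ x y x' y' : ℤ, n' * x - m' * y = n' * x' - m' * y' →
      ∃ z : ℤ, p x' y' - p x y = k * z := by
    intro x y x' y' h
    have hd : n' ∣ m' * (y' - y) := ⟨x' - x, by linarith⟩
    obtain ⟨t, ht⟩ := hcop.dvd_of_dvd_mul_left hd
    have hx : x' = x + t * m' := by
      apply mul_left_cancel₀ hn'.ne'
      have : y' = y + n' * t := by linarith
      subst this
      linarith
    have hy : y' = y + t * n' := by linarith
    refine ⟨t, ?_⟩
    subst hx hy
    push_cast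
    rw [htr]; ring
  have hform : ∀ x y : ℝ, p x y =
      q / 2 * (n' * x - m' * y) ^ 2 + d / n' * (n' * x - m' * y) + k / n' * y + f := by
    intro x y
    rw [hp', ← hstep]
    field_simp
    ring
  set α : ℝ := d / n' with hα
  obtain ⟨j₀, hj₀⟩ := exists_nat_ge (2 * |α| + k + α ^ 2 + (k : ℝ) ^ 2 + |α| * k + 2)
  refine ⟨j₀, ?_⟩
  intro j hj a b a' b' hab hab'
  have hjR : (j₀ : ℝ) ≤ j := by exact_mod_cast hj
  rw [hst, hsec] at hab
  rw [hst] at hab'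
  obtain ⟨⟨ha0, hb0, hbl⟩, habj⟩ := hab
  obtain ⟨-, habk⟩ := hab'
  rw [habj] at hbl
  -- the last stair
  obtain ⟨t, ht0, ht1, ht2⟩ : ∃ t : ℤ, 0 ≤ t ∧ b + t * n' ≤ l * j ∧ l * j < b + t * n' + n' := by
    refine ⟨(l * j - b) / n', Int.ediv_nonneg (by linarith) hn'.le, ?_, ?_⟩
    · have := Int.ediv_mul_le (l * j - b) hn'.ne'
      linarith
    · have := Int.lt_ediv_add_one_mul_self (l * j - b) hn'
      linarith
  obtain ⟨A, hA⟩ : ∃ A, A = a + t * m' := ⟨_, rfl⟩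
  obtain ⟨B, hB⟩ : ∃ B, B = b + t * n' := ⟨_, rfl⟩
  have htm : 0 ≤ t * m' := by positivity
  have htn : 0 ≤ t * n' := by positivity
  have hAB : n' * A - m' * B = j := by rw [hA, hB, ← habj]; ring
  rw [← hB] at ht1 ht2
  have hABs : (A, B) ∈ sectorLattice (n : ℤ) ((M + 1 : ℕ) : ℤ) := by
    rw [hsec, hAB]
    exact ⟨by linarith, by linarith, ht1⟩
  obtain ⟨v, hv⟩ := hnat _ hABs
  obtain ⟨⟨x, y⟩, hP, hPv⟩ := hsurj (v + k)
  simp only at hv hPv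
  push_cast at hPv
  have hPs := (hsec x y).1 hP
  obtain ⟨hx0, hy0, hyl⟩ := hPs
  have hc0 : 0 ≤ n' * x - m' * y := by
    by_contra hneg
    push Not at hneg
    nlinarith
  have hyn : y < n' := by
    by_contra hge
    push Not at hge
    have hmem : (x - m', y - n') ∈ sectorLattice (n : ℤ) ((M + 1 : ℕ) : ℤ) := by
      rw [hsec]
      refine ⟨?_, by linarith, ?_⟩
      · by_contra hneg
        push Not at hneg
        have e1 : n' * (x - m') < 0 := mul_neg_of_pos_of_neg hn' hneg
        have e2 : 0 ≤ m' * (y - n') := mul_nonneg hm'.le (by linarith)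
        linarith
      · have : n' * (x - m') - m' * (y - n') = n' * x - m' * y := by ring
        rw [this]; linarith
    have heq := hinj hmem hABs (by
      simp only
      have h := htr x y (-1)
      push_cast
      rw [show (x : ℝ) - m' = x + (-1) * m' by ring, show (y : ℝ) - n' = y + (-1) * n' by ring, h,
        hPv, hv]
      ring)
    have e1 := congrArg Prod.fst heq
    have e2 := congrArg Prod.snd heq
    simp only at e1 e2
    have hx : x = A + m' := by linarith
    have hy : y = B + n' := by linarith
    have : n' * x - m' * y = j := by rw [hx, hy, ← hAB]; ring
    rw [this] at hyl
    linarith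
  obtain ⟨c, hc⟩ : ∃ c : ℤ, c = n' * x - m' * y := ⟨_, rfl⟩
  rw [← hc] at hc0 hyl
  have hcR : (n' : ℝ) * x - m' * y = c := by rw [hc]; push_cast; ring
  have hABR : (n' : ℝ) * A - m' * B = j := by exact_mod_cast hAB
  have hkey : p x y = p A B + k := by rw [hPv, hv]
  rw [hform x y, hform A B, hcR, hABR] at hkey
  have hknp : (0 : ℝ) ≤ k / n' := by positivity
  have hkn : (k : ℝ) / n' * n' = k := by field_simp
  have hy1 : (k : ℝ) / n' * y ≤ k := by
    have : (y : ℝ) ≤ n' := by exact_mod_cast hyn.le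
    nlinarith
  have hy2 : 0 ≤ (k : ℝ) / n' * y := by
    have : (0 : ℝ) ≤ y := by exact_mod_cast hy0
    positivity
  have hkl : (k : ℝ) / n' * (l * j) = k * q * j := by rw [hlqR]; field_simp
  have hB1 : (k : ℝ) / n' * B ≤ k * q * j := by
    have : (B : ℝ) ≤ l * j := by exact_mod_cast ht1
    rw [← hkl]; exact mul_le_mul_of_nonneg_left this hknp
  have hB2 : (k : ℝ) * q * j ≤ k / n' * B + k := by
    have : (l : ℝ) * j ≤ B + n' := by exact_mod_cast ht2.le
    have := mul_le_mul_of_nonneg_left this hknp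
    rw [← hkl]; linarith
  have hcj : c = j + k := by
    by_contra hne
    have hc0R : (0 : ℝ) ≤ c := by exact_mod_cast hc0
    refine quad_force q k j (c - j) α hqR hkR (by linarith) (by linarith) ?_ ?_ ?_
    · have : c - j ≤ -1 ∨ (0 ≤ c - j ∧ c - j ≤ k - 1) ∨ (k : ℤ) + 1 ≤ c - j := by omega
      exact_mod_cast this
    · linarith
    · linarith
  obtain ⟨z1, hz1⟩ := hsame x y a' b' (by rw [← hc, hcj, habk]; push_cast; ring)
  refine ⟨z1 + 1 + t, ?_⟩
  have hlast : p A B = p a b + k * t := by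
    rw [hA, hB]; push_cast; exact htr a b t
  push_cast
  have : p x y = p A B + k := by rw [hPv, hv]
  linarith
end

section
/- Let m, n be coprime positive integers with m ≥ 2 and n dividing (m−1)², set l = gcd(n, m−1), and let p be an ascending k-stair packing polynomial on S(n/m) with k ≥ 1. Then there exists j₀ ∈ ℕ such that for all integers j ≥ j₀, if (a,b) is the first stair on the (j·(n/l) + k)-th staircase, then p(a,b) − k = p(m·j, n·j). -/
/-- Normal form of the polynomial in the coordinates `c = v x - u y` and `y`. -/
lemma stair_normal_form (n m l u v : ℕ) (hl : 0 < l) (hu : 0 < u) (hv : 0 < v)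
    (hn : n = l * v) (hm : m = l * u + 1) (huv : Nat.Coprime u v)
    (hg : Int.gcd (n : ℤ) ((m : ℤ) - 1) = l) (k : ℕ)
    (p : ℝ → ℝ → ℝ) (hstair : IsAscendingKStair (n : ℤ) (m : ℤ) k p) :
    ∃ β f : ℝ, ∀ x y : ℝ, p x y = (l : ℝ) / (2 * v) * (v * x - u * y) ^ 2
      + β * (v * x - u * y) + (k : ℝ) / v * y + f := by
  obtain ⟨⟨⟨d, e, f, hp⟩, -, -⟩, hasc⟩ := hstair
  have hvR : (v : ℝ) ≠ 0 := by positivity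
  have hlR : (l : ℝ) ≠ 0 := by positivity
  have hp' : ∀ x y : ℝ, p x y = (l : ℝ) / (2 * v) * (v * x - u * y) ^ 2
      + d * x + e * y + f := by
    intro x y
    rw [hp, hn, hm]
    push_cast
    field_simp
    ring
  have hcons : ConsecutiveStairs (n : ℤ) (m : ℤ) (1, 0) (1 + u, v) := by
    refine ⟨v, ⟨⟨by norm_num, by norm_num, by simp⟩, ?_⟩, ⟨⟨by simp; positivity, by simp, ?_⟩, ?_⟩,
      ?_, ?_⟩
    · rw [hg, hn]; push_cast; ring
    · simp only [hn, hm]; push_cast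
      have h1 : (v : ℤ) ≤ l * v := by
        have : (1 : ℤ) ≤ l := by exact_mod_cast hl
        nlinarith [Int.natCast_nonneg v]
      nlinarith
    · rw [hg, hn, hm]; push_cast; ring
    · intro h
      have := congrArg Prod.snd h
      simp at this
      omega
    · rintro ⟨x, y⟩ ⟨-, ht⟩ ⟨h1, h2⟩
      rw [hg, hn, hm] at ht
      push_cast at ht
      simp only at ht h1 h2
      have hux : (0 : ℤ) ≤ u := by positivity
      rw [min_eq_left (by omega)] at h1
      rw [max_eq_right (by omega)] at h2
      have hlZ : (l : ℤ) ≠ 0 := by positivity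
      have e1 : (v : ℤ) * (x - 1) = u * y := by
        apply mul_left_cancel₀ hlZ
        linarith
      have hd : (u : ℤ) ∣ v * (x - 1) := ⟨y, e1⟩
      have hd2 : (u : ℤ) ∣ x - 1 :=
        (Nat.isCoprime_iff_coprime.mpr huv).dvd_of_dvd_mul_left hd
      have := Int.le_of_dvd (by omega) hd2
      omega
  have hk := hasc _ _ hcons (by
    have : (0 : ℤ) < u := by exact_mod_cast hu
    have : (0 : ℤ) < v := by exact_mod_cast hv
    simp only
    nlinarith)
  rw [hp', hp'] at hk
  push_cast at hk
  have hk' : d * u + e * v = k := by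
    rw [← hk]; ring
  refine ⟨d / v, f, fun x y => ?_⟩
  rw [hp', ← hk']
  field_simp
  ring

set_option maxHeartbeats 2000000 in
theorem first_stair_value (n m : ℕ) (hn : 0 < n) (hm : 2 ≤ m)
    (hco : Nat.Coprime n m) (hdvd : n ∣ (m - 1) ^ 2) (k : ℕ) (hk : 1 ≤ k)
    (p : ℝ → ℝ → ℝ) (hstair : IsAscendingKStair (n : ℤ) (m : ℤ) k p)
    (hpack : IsPackingPolyOn p (sectorLattice (n : ℤ) (m : ℤ))) :
    ∃ j₀ : ℕ, ∀ j : ℕ, j₀ ≤ j → ∀ P : ℤ × ℤ,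
      IsFirstStair (n : ℤ) (m : ℤ) (j * (n / Nat.gcd n (m - 1)) + k) P →
      p P.1 P.2 - (k : ℝ) = p ((m : ℝ) * (j : ℝ)) ((n : ℝ) * (j : ℝ)) := by
  obtain ⟨l, hldef⟩ : ∃ l, l = Nat.gcd n (m - 1) := ⟨_, rfl⟩
  have hl : 0 < l := hldef ▸ Nat.gcd_pos_of_pos_left _ hn
  obtain ⟨v, hnv⟩ : l ∣ n := hldef ▸ Nat.gcd_dvd_left _ _
  obtain ⟨u, hmu⟩ : l ∣ m - 1 := hldef ▸ Nat.gcd_dvd_right _ _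
  have hv : 0 < v := Nat.pos_of_ne_zero (by rintro rfl; simp at hnv; omega)
  have hu : 0 < u := Nat.pos_of_ne_zero (by rintro rfl; simp at hmu; omega)
  have hmu' : m = l * u + 1 := by omega
  have huv : Nat.Coprime u v := by
    have h : l * Nat.gcd v u = l * 1 := by
      rw [← Nat.gcd_mul_left, ← hnv, ← hmu, ← hldef, mul_one]
    exact (Nat.Coprime.symm (Nat.eq_of_mul_eq_mul_left hl h))
  have hg : Int.gcd (n : ℤ) ((m : ℤ) - 1) = l := by
    have : ((m : ℤ) - 1) = ((m - 1 : ℕ) : ℤ) := by push_cast [show 1 ≤ m by omega]; ring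
    rw [this, Int.gcd_natCast_natCast, ← hldef]
  have hq : n / Nat.gcd n (m - 1) = v := by
    rw [← hldef, hnv]; exact Nat.mul_div_cancel_left _ hl
  rw [hq]
  obtain ⟨β, f, hp⟩ := stair_normal_form n m l u v hl hu hv hnv hmu' huv hg k p hstair
  obtain ⟨hnat, hinj, hsurj⟩ := hpack
  have hlZ : (0 : ℤ) < l := by exact_mod_cast hl
  have hvZ : (0 : ℤ) < v := by exact_mod_cast hv
  have huZ : (0 : ℤ) < u := by exact_mod_cast hu
  have hnZ : (n : ℤ) = l * v := by exact_mod_cast hnv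
  have hmZ : (m : ℤ) = l * u + 1 := by exact_mod_cast hmu'
  have hvR : (0 : ℝ) < v := by exact_mod_cast hv
  have hlR : (0 : ℝ) < l := by exact_mod_cast hl
  have hnR : (n : ℝ) = l * v := by exact_mod_cast hnv
  have hmR : (m : ℝ) = l * u + 1 := by exact_mod_cast hmu'
  have hcn : ∀ Q ∈ sectorLattice (n : ℤ) (m : ℤ), 0 ≤ (v : ℤ) * Q.1 - u * Q.2 := by
    rintro ⟨x, y⟩ ⟨hx, hy, hxy⟩
    simp only [hnZ, hmZ] at *
    have : 0 ≤ (l : ℤ) * ((v : ℤ) * x - u * y) := by nlinarith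
    exact nonneg_of_mul_nonneg_right this hlZ
  have hback : ∀ Q ∈ sectorLattice (n : ℤ) (m : ℤ), (v : ℤ) ≤ Q.2 →
      (Q.1 - u, Q.2 - v) ∈ sectorLattice (n : ℤ) (m : ℤ) := by
    intro Q hQ hQv
    have h0 := hcn Q hQ
    obtain ⟨x, y⟩ := Q
    obtain ⟨hx, hy, hxy⟩ := hQ
    simp only [hnZ, hmZ] at *
    refine ⟨?_, ?_, ?_⟩
    · have : 0 ≤ (v : ℤ) * (x - u) := by nlinarith
      exact nonneg_of_mul_nonneg_right this hvZ
    · simp only; omega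
    · simp only [hnZ, hmZ]; nlinarith
  set α : ℝ := (l : ℝ) / (2 * v) with hα
  set γ : ℝ := (k : ℝ) / v with hγ
  have hα0 : 0 < α := by positivity
  have hγ0 : 0 ≤ γ := by positivity
  have hγv : γ * v = k := by rw [hγ]; field_simp
  have hαv : 2 * α * v = l := by rw [hα]; field_simp
  set K : ℝ := -α * k ^ 2 - β * k + k with hK
  obtain ⟨j₀, hj₀⟩ := exists_nat_gt ((k + |K| + |β|) / α)
  refine ⟨j₀, fun j hj P hP => ?_⟩
  obtain ⟨⟨hPI, hPc⟩, hPmin⟩ := hP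
  have hPc' : (v : ℤ) * P.1 - u * P.2 = j * v + k := by
    rw [hg, hnZ, hmZ] at hPc
    push_cast at hPc
    apply mul_left_cancel₀ hlZ.ne'
    linarith
  have hPv : P.2 < v := by
    by_contra hcon
    have h1 := hback P hPI (by omega)
    have h2 := hPmin (P.1 - u, P.2 - v) ⟨h1, by
      rw [hg, hnZ, hmZ] at *
      push_cast at *
      linarith⟩
    simp only at h2
    omega
  have hRI : ((m : ℤ) * j, (n : ℤ) * j) ∈ sectorLattice (n : ℤ) (m : ℤ) :=
    ⟨by positivity, by positivity, by simp only; apply le_of_eq; ring⟩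
  obtain ⟨t, ht⟩ := hnat _ hRI
  obtain ⟨Q, hQI, hQ⟩ := hsurj (t + k)
  push_cast at ht hQ
  rw [← ht] at hQ
  have hQv : Q.2 < v := by
    by_contra hcon
    have h1 := hback Q hQI (by omega)
    have h2 := hinj h1 hRI (by
      simp only
      push_cast
      have : p ((Q.1 : ℝ) - u) ((Q.2 : ℝ) - v) = p Q.1 Q.2 - k := by
        rw [hp, hp, ← hγv]; ring
      rw [this, hQ]; ring)
    have e1 : Q.1 - u = (m : ℤ) * j := congrArg Prod.fst h2
    have e2 : Q.2 - v = (n : ℤ) * j := congrArg Prod.snd h2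
    have h3 := hQI.2.2
    have e1' : Q.1 = (m : ℤ) * j + u := by omega
    have e2' : Q.2 = (n : ℤ) * j + v := by omega
    rw [e1', e2', hnZ, hmZ] at h3
    nlinarith
  have hQ0 : 0 ≤ Q.2 := hQI.2.1
  obtain ⟨c, hc⟩ : ∃ c : ℤ, c = (v : ℤ) * Q.1 - u * Q.2 := ⟨_, rfl⟩
  have hc0 : 0 ≤ c := hc ▸ hcn Q hQI
  have hcR : (c : ℝ) = v * Q.1 - u * Q.2 := by exact_mod_cast hc
  have hmain : α * (c ^ 2 - (j * v + k) ^ 2) + β * (c - (j * v + k)) = K - γ * Q.2 := by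
    have h := hQ
    rw [hp, hp, ← hcR] at h
    have e : (v : ℝ) * (m * j) - u * (n * j) = j * v := by rw [hnR, hmR]; ring
    rw [e, hnR] at h
    have e3 : γ * (l * v * j) = 2 * α * (j * v) * k := by
      rw [← hγv, ← hαv]; ring
    rw [e3] at h
    rw [hK]
    linarith
  have hceq : c = j * v + k := by
    by_contra hne
    have h1 : (1 : ℝ) ≤ |(c : ℝ) - (j * v + k)| := by
      have : (1 : ℤ) ≤ |c - (j * v + k)| := Int.one_le_abs (sub_ne_zero.mpr hne)
      exact_mod_cast this
    have hc0R : (0 : ℝ) ≤ c := by exact_mod_cast hc0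
    have hjc : (j : ℝ) ≤ j * v + k := by
      have : (1 : ℝ) ≤ v := by exact_mod_cast hv
      have : (0 : ℝ) ≤ j := by positivity
      have : (0 : ℝ) ≤ k := by positivity
      nlinarith
    have hjj : (j₀ : ℝ) ≤ j := by exact_mod_cast hj
    rw [div_lt_iff₀ hα0] at hj₀
    have h2 : k + |K| + |β| < α * (c + (j * v + k)) := by
      have : α * j₀ ≤ α * (c + (j * v + k)) := by gcongr; linarith
      linarith
    have h3 : k + |K| < α * (c + (j * v + k)) + β := by linarith [neg_abs_le β]
    have hprod : ((c : ℝ) - (j * v + k)) * (α * (c + (j * v + k)) + β) = K - γ * Q.2 := by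
      rw [← hmain]; ring
    have h4 : |K - γ * Q.2| ≤ k + |K| := by
      have hy1 : γ * Q.2 ≤ γ * v := by
        have : (Q.2 : ℝ) ≤ v := by exact_mod_cast hQv.le
        gcongr
      have hy0 : 0 ≤ γ * Q.2 := by
        have : (0 : ℝ) ≤ Q.2 := by exact_mod_cast hQ0
        positivity
      rw [abs_le]
      constructor <;> linarith [neg_abs_le K, le_abs_self K, abs_nonneg K]
    rw [← hprod, abs_mul] at h4
    have h5 := le_abs_self (α * (c + (j * v + k)) + β)
    have h6 := abs_nonneg K
    have h7 : (0 : ℝ) ≤ k := by positivity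
    nlinarith
  have hPQ : (v : ℤ) * (P.1 - Q.1) = u * (P.2 - Q.2) := by linarith
  have hd : (v : ℤ) ∣ P.2 - Q.2 :=
    (Nat.isCoprime_iff_coprime.mpr huv.symm).dvd_of_dvd_mul_left ⟨_, hPQ.symm⟩
  have hP0 : 0 ≤ P.2 := hPI.2.1
  have h2 : P.2 - Q.2 = 0 := Int.eq_zero_of_abs_lt_dvd hd (by rw [abs_lt]; omega)
  have h1 : P.1 - Q.1 = 0 := by
    rw [h2, mul_zero] at hPQ
    exact (mul_eq_zero.mp hPQ).resolve_left hvZ.ne'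
  have e2 : P.2 = Q.2 := by omega
  have e1 : P.1 = Q.1 := by omega
  rw [e1, e2, hQ]; ring
end

section
/- Let m, n be coprime positive integers with m ≥ 2 and n dividing (m−1)², set l = gcd(n, m−1), and let p be an ascending k-stair packing polynomial on S(n/m) with k ≥ 1. Then there exists j₀ ∈ ℕ such that for all integers j ≥ j₀ with j ≥ k: if (a,b) is the first stair on the j-th staircase and (c,d) = (m·(j−k)·l/n, (j−k)·l) is the (real) intersection point of the line y = (n/m)x with the (j−k)-th staircase line, then p(a,b) − k ≤ p(c,d), where p is evaluated as a real polynomial. -/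
/-- Membership in the sector, in terms of `l, M, N` with `n = l N`, `m = l M + 1`. -/
lemma fs_sector_iff (l M N x y : ℤ) :
    (x, y) ∈ sectorLattice (l * N) (l * M + 1) ↔ 0 ≤ x ∧ 0 ≤ y ∧ y ≤ l * (N * x - M * y) := by
  simp only [sectorLattice, Set.mem_ofPred_eq]
  constructor
  · rintro ⟨h1, h2, h3⟩
    exact ⟨h1, h2, by linarith⟩
  · rintro ⟨h1, h2, h3⟩
    exact ⟨h1, h2, by linarith⟩

lemma fs_stair_iff (l M N x y : ℤ) (c : ℕ) (hl : 0 < l)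
    (hg : (Int.gcd (l * N) (l * M + 1 - 1) : ℤ) = l) :
    (x, y) ∈ staircase (l * N) (l * M + 1) c ↔
      0 ≤ x ∧ 0 ≤ y ∧ y ≤ l * c ∧ N * x - M * y = c := by
  simp only [staircase, Set.mem_ofPred_eq, fs_sector_iff, hg]
  constructor
  · rintro ⟨⟨h1, h2, h3⟩, h4⟩
    have h5 : N * x - M * y = c := by
      apply mul_left_cancel₀ hl.ne'
      linarith
    rw [h5] at h3
    exact ⟨h1, h2, h3, h5⟩
  · rintro ⟨h1, h2, h3, h5⟩
    refine ⟨⟨h1, h2, by rw [h5]; exact h3⟩, ?_⟩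
    rw [← h5]; ring

/-- The purely real-analytic core. -/
lemma fs_mono (A B s t : ℝ) (hA : 0 < A) (hs : 0 ≤ s) (hst : s + 1 ≤ t) (h : 0 ≤ A * t + B) :
    A * s ^ 2 + B * s + (A * t + B) ≤ A * t ^ 2 + B * t := by
  nlinarith [mul_nonneg (sub_nonneg.2 hst) h, mul_nonneg (mul_nonneg hA.le hs)
    (by linarith : (0:ℝ) ≤ t - s)]

set_option maxHeartbeats 1000000 in
lemma fs_core (l M N : ℤ) (hl : 0 < l) (hM : 0 < M) (hN : 0 < N) (hMN : IsCoprime M N)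
    (hg : (Int.gcd (l * N) (l * M + 1 - 1) : ℤ) = l) (k : ℕ) (hk : 1 ≤ k)
    (p : ℝ → ℝ → ℝ) (hstair : IsAscendingKStair (l * N) (l * M + 1) k p)
    (hpack : IsPackingPolyOn p (sectorLattice (l * N) (l * M + 1))) :
    ∃ j₀ : ℕ, ∀ j : ℕ, j₀ ≤ j → k ≤ j → ∀ P : ℤ × ℤ,
      IsFirstStair (l * N) (l * M + 1) j P →
      p P.1 P.2 - (k : ℝ) ≤
        p (((l * M + 1 : ℤ) : ℝ) * ((j : ℝ) - (k : ℝ)) * (l : ℝ) / ((l * N : ℤ) : ℝ))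
          (((j : ℝ) - (k : ℝ)) * (l : ℝ)) := by
  obtain ⟨⟨⟨d, e, f, hp⟩, -, -⟩, hasc⟩ := hstair
  obtain ⟨hnat, hinj, hsurj⟩ := hpack
  have hlR : (0:ℝ) < l := by exact_mod_cast hl
  have hMR : (0:ℝ) < M := by exact_mod_cast hM
  have hNR : (0:ℝ) < N := by exact_mod_cast hN
  have hkR : (1:ℝ) ≤ k := by exact_mod_cast hk
  -- the relation between `d`, `e`, `k`
  have hde : d * M + e * N = k := by
    have hc : ConsecutiveStairs (l * N) (l * M + 1) (l, 0) (l + M, N) := by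
      refine ⟨(N * l).toNat, ?_, ?_, ?_, ?_⟩
      · rw [fs_stair_iff _ _ _ _ _ _ hl hg, Int.toNat_of_nonneg (by positivity)]
        refine ⟨hl.le, le_rfl, by positivity, by ring⟩
      · rw [fs_stair_iff _ _ _ _ _ _ hl hg, Int.toNat_of_nonneg (by positivity)]
        refine ⟨by positivity, hN.le, by nlinarith [mul_pos hl hN, mul_pos hl hl], by ring⟩
      · intro h
        have := congrArg Prod.snd h
        simp at this
        omega
      · rintro ⟨x, y⟩ ht ⟨h1, h2⟩
        rw [fs_stair_iff _ _ _ _ _ _ hl hg, Int.toNat_of_nonneg (by positivity)] at ht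
        obtain ⟨-, -, -, h4⟩ := ht
        simp only at h1 h2
        rw [min_eq_left (by omega)] at h1
        rw [max_eq_right (by omega)] at h2
        have h5 : M ∣ N * (x - l) := ⟨y, by linarith⟩
        have h6 : M ∣ x - l := hMN.dvd_of_dvd_mul_left h5
        have := Int.le_of_dvd (by omega) h6
        omega
    have h := hasc _ _ hc (by simp only; nlinarith)
    simp only [hp] at h
    push_cast at h
    have : ((l:ℝ) * N) / 2 * (l + M - (l * M + 1 - 1) / (l * N) * N) ^ 2 =
        ((l:ℝ) * N) / 2 * (l - (l * M + 1 - 1) / (l * N) * 0) ^ 2 := by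
      field_simp
      ring
    linarith
  obtain ⟨A, hA⟩ : ∃ A : ℝ, A = l / (2 * N) := ⟨_, rfl⟩
  obtain ⟨B, hB⟩ : ∃ B : ℝ, B = d / N := ⟨_, rfl⟩
  obtain ⟨c, hc⟩ : ∃ c : ℝ, c = k / N := ⟨_, rfl⟩
  have hA0 : 0 < A := by rw [hA]; positivity
  have hc0 : 0 < c := by rw [hc]; positivity
  have hcl : c * l = 2 * A * k := by rw [hc, hA]; field_simp
  have hcN : c * N = k := by rw [hc]; field_simp
  have hform : ∀ x y u : ℝ, u = N * x - M * y →
      p x y = A * u ^ 2 + B * u + c * y + f := by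
    intro x y u hu
    rw [hp, hu, hA, hB, hc, ← hde]
    push_cast
    field_simp
    ring
  have hformZ : ∀ (x y : ℤ) (u : ℤ), N * x - M * y = u →
      p x y = A * (u:ℝ) ^ 2 + B * u + c * y + f := by
    intro x y u hu
    apply hform
    rw [← hu]; push_cast; ring
  obtain ⟨j₁, hj₁⟩ := exists_nat_gt ((k + A * k ^ 2 + |B| * k + |f| + 1 - B) / A)
  refine ⟨j₁ + 1, fun j hj hkj P hP => ?_⟩
  obtain ⟨a, b⟩ := P
  obtain ⟨hPs, hPmin⟩ := hP
  have hPs' := (fs_stair_iff _ _ _ _ _ _ hl hg).1 hPs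
  obtain ⟨ha, hb, hbl, hu⟩ := hPs'
  simp only
  have hAj : k + A * k ^ 2 + |B| * k + |f| + 1 ≤ A * j + B := by
    rw [div_lt_iff₀ hA0] at hj₁
    have : (j₁:ℝ) ≤ j := by exact_mod_cast (by omega : j₁ ≤ j)
    nlinarith
  have hBk0 : 0 ≤ |B| * k := by positivity
  have hBk1 : B * k ≤ |B| * k := by
    have := le_abs_self B
    gcongr
  have hBk2 : -(B * k) ≤ |B| * k := by
    have := neg_le_abs B
    nlinarith
  have hf1 := neg_le_abs f
  have hf0 := abs_nonneg f
  have hAk : 0 ≤ A * (k:ℝ) ^ 2 := by positivity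
  have hbN : b < N := by
    by_contra hcon
    push Not at hcon
    have hx : M ≤ a := by
      by_contra h
      push Not at h
      have : (0:ℤ) ≤ j := by positivity
      nlinarith
    have := hPmin (a - M, b - N) ((fs_stair_iff _ _ _ _ _ _ hl hg).2
      ⟨by omega, by omega, by omega, by linarith⟩)
    simp only at this
    omega
  have hbR : (0:ℝ) ≤ b := by exact_mod_cast hb
  have hbNR : (b:ℝ) < N := by exact_mod_cast hbN
  have hcb0 : 0 ≤ c * b := by positivity
  have hcb : c * b < k := by rw [← hcN]; gcongr
  have hpP := hformZ a b j hu
  push_cast at hpP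
  have hj1 : (1:ℝ) ≤ j := by exact_mod_cast (by omega : 1 ≤ j)
  -- `p P - k` is a natural number
  obtain ⟨v, hv⟩ := hnat (a, b) hPs.1
  simp only at hv
  have hpos : (k:ℝ) ≤ p a b := by
    have := fs_mono A B 0 j hA0 le_rfl (by linarith) (by linarith)
    linarith
  have hkv : k ≤ v := by rw [hv] at hpos; exact_mod_cast hpos
  obtain ⟨⟨x, y⟩, hQ, hpQ⟩ := hsurj (v - k)
  simp only at hpQ
  rw [Nat.cast_sub hkv, ← hv] at hpQ
  rw [← hpQ]
  have hQ' := (fs_sector_iff _ _ _ _ _).1 hQ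
  obtain ⟨hx, hy, hyl⟩ := hQ'
  obtain ⟨i, hi⟩ : ∃ i : ℤ, i = N * x - M * y := ⟨_, rfl⟩
  rw [← hi] at hyl
  have hi0 : 0 ≤ i := by
    by_contra h
    push Not at h
    nlinarith
  have hiR : (0:ℝ) ≤ i := by exact_mod_cast hi0
  have hpx := hformZ x y i hi.symm
  have hyR : (0:ℝ) ≤ y := by exact_mod_cast hy
  have hylR : (y:ℝ) ≤ l * i := by exact_mod_cast hyl
  have hcy0 : 0 ≤ c * y := by positivity
  have hcy : c * y ≤ 2 * A * k * i := by
    calc c * y ≤ c * (l * i) := by gcongr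
      _ = 2 * A * k * i := by rw [← mul_assoc, hcl]
  -- target in normal form
  have htgt : p (((l * M + 1 : ℤ) : ℝ) * ((j : ℝ) - (k : ℝ)) * (l : ℝ) / ((l * N : ℤ) : ℝ))
          (((j : ℝ) - (k : ℝ)) * (l : ℝ)) =
      A * ((j:ℝ) - k) ^ 2 + B * ((j:ℝ) - k) + c * (((j : ℝ) - (k : ℝ)) * (l : ℝ)) + f := by
    apply hform
    push_cast
    field_simp
    ring
  rw [htgt]
  rcases lt_trichotomy i ((j:ℤ) - k) with hlt | heq | hgt
  · exfalso
    have h1 : (i:ℝ) + k + 1 ≤ j := by exact_mod_cast (by omega : i + k + 1 ≤ (j:ℤ))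
    have := fs_mono A B (i + k) j hA0 (by positivity) h1 (by linarith)
    linarith
  · have h1 : (i:ℝ) = j - k := by rw [heq]; push_cast; ring
    rw [hpx, h1]
    rw [h1] at hylR
    have : c * y ≤ c * (((j:ℝ) - k) * l) := by
      rw [mul_comm _ (l:ℝ)]
      gcongr
    linarith
  · exfalso
    rcases lt_trichotomy i (j:ℤ) with h2 | h2 | h2
    · by_cases hlast : y + N ≤ l * i
      · have hmem : (x + M, y + N) ∈ sectorLattice (l * N) (l * M + 1) := by
          rw [fs_sector_iff]
          refine ⟨by omega, by omega, ?_⟩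
          have : N * (x + M) - M * (y + N) = i := by rw [hi]; ring
          rw [this]; exact hlast
        have hnext := hformZ (x + M) (y + N) i (by rw [hi]; ring)
        have hval : p ((x + M : ℤ) : ℝ) ((y + N : ℤ) : ℝ) = p a b := by
          rw [hnext]
          push_cast
          linarith
        have heq := hinj hmem hPs.1 hval
        have e1 : x + M = a := congrArg Prod.fst heq
        have e2 : y + N = b := congrArg Prod.snd heq
        rw [← e1, ← e2] at hu
        have : N * (x + M) - M * (y + N) = i := by rw [hi]; ring
        omega
      · push Not at hlast
        have hlR' : (l:ℝ) * i < y + N := by exact_mod_cast hlast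
        have h3 : 2 * A * k * i < c * y + k := by
          calc 2 * A * k * i = c * (l * i) := by rw [← mul_assoc, hcl]
            _ < c * (y + N) := by gcongr
            _ = c * y + k := by rw [mul_add, hcN]
        have h1 : (j:ℝ) + 1 ≤ i + k := by exact_mod_cast (by omega : (j:ℤ) + 1 ≤ i + k)
        have h4 : A * j ≤ A * (i + k) := by gcongr; linarith
        have := fs_mono A B j (i + k) hA0 (by positivity) h1 (by linarith)
        linarith
    · subst h2
      push_cast at hpx
      have h3 : c * ((y:ℝ) + N - b) = 0 := by
        rw [mul_sub, mul_add, hcN]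
        linarith
      have h4 : (y:ℝ) + N - b = 0 := by
        rcases mul_eq_zero.1 h3 with h | h
        · linarith
        · exact h
      linarith
    · have h1 : (j:ℝ) + 1 ≤ i := by exact_mod_cast (by omega : (j:ℤ) + 1 ≤ i)
      have h4 : A * j ≤ A * i := by gcongr; linarith
      have := fs_mono A B j i hA0 (by positivity) h1 (by linarith)
      linarith

/-- If `p` is an ascending `k`-stair packing polynomial on `S(n/m)` (`k ≥ 1`),
then there is `j₀` such that for all `j ≥ j₀` with `j ≥ k`: if `(a,b)` is the first stair
on the `j`-th staircase and `(c,d) = (m·(j−k)·l/n, (j−k)·l)` is the intersection of the line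
`y = (n/m)x` with the `(j−k)`-th staircase line, then `p(a,b) − k ≤ p(c,d)`. -/
theorem first_stair_inequality (n m : ℕ) (hn : 0 < n) (hm : 2 ≤ m)
    (hco : Nat.Coprime n m) (hdvd : n ∣ (m - 1) ^ 2) (k : ℕ) (hk : 1 ≤ k)
    (p : ℝ → ℝ → ℝ) (hstair : IsAscendingKStair (n : ℤ) (m : ℤ) k p)
    (hpack : IsPackingPolyOn p (sectorLattice (n : ℤ) (m : ℤ))) :
    ∃ j₀ : ℕ, ∀ j : ℕ, j₀ ≤ j → k ≤ j → ∀ P : ℤ × ℤ,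
      IsFirstStair (n : ℤ) (m : ℤ) j P →
      p P.1 P.2 - (k : ℝ) ≤
        p ((m : ℝ) * ((j : ℝ) - (k : ℝ)) * (Nat.gcd n (m - 1) : ℝ) / (n : ℝ))
          (((j : ℝ) - (k : ℝ)) * (Nat.gcd n (m - 1) : ℝ)) := by
  obtain ⟨l, hl⟩ : ∃ l, l = Nat.gcd n (m - 1) := ⟨_, rfl⟩
  rw [← hl]
  have hl0 : 0 < l := by rw [hl]; exact Nat.gcd_pos_of_pos_left _ hn
  obtain ⟨g, N, M, hg0, hcop, hnN, hmM⟩ := Nat.exists_coprime' (m := n) (n := m - 1) (hl ▸ hl0)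
  have hgl : g = l := by
    rw [hl, hnN, hmM, Nat.gcd_mul_right, hcop.gcd_eq_one, one_mul]
  subst hgl
  have hm' : m = g * M + 1 := by rw [mul_comm]; omega
  have hn' : n = g * N := by rw [mul_comm]; exact hnN
  have hN : 0 < N := Nat.pos_of_ne_zero (by rintro rfl; simp at hn'; omega)
  have hM : 0 < M := Nat.pos_of_ne_zero (by rintro rfl; simp at hm'; omega)
  have hnZ : (n : ℤ) = (g : ℤ) * (N : ℤ) := by rw [hn']; push_cast; ring
  have hmZ : (m : ℤ) = (g : ℤ) * (M : ℤ) + 1 := by rw [hm']; push_cast; ring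
  have hgcd : (Int.gcd ((g : ℤ) * N) ((g : ℤ) * M + 1 - 1) : ℤ) = g := by
    rw [add_sub_cancel_right, Int.gcd_mul_left, Int.gcd_natCast_natCast, hcop.gcd_eq_one]
    simp
  rw [hnZ, hmZ] at hstair hpack
  have key := fs_core g M N (by exact_mod_cast hl0) (by exact_mod_cast hM)
    (by exact_mod_cast hN) (Nat.isCoprime_iff_coprime.2 hcop.symm) hgcd k hk p hstair hpack
  rw [← hnZ, ← hmZ] at key
  exact_mod_cast key
end

section
/- Let m, n be coprime positive integers with m ≥ 2 and n dividing (m−1)², and set l = gcd(n, m−1). Let r be the multiplicative inverse of (m−1)/l modulo n/l. For j ∈ ℕ, let j' ≡ j (mod n/l) and let z be the residue of −j'·r modulo n/l with 0 ≤ z < n/l. Then, whenever the j-th staircase S_j is nonempty, its first stair has coordinates (((m−1)/n)·z + j·(l/n), z); in particular ((m−1)·z + j·l)/n is an integer. -/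
/-- Let `l = gcd(n, m−1)`, let `r` be the multiplicative inverse of
`(m−1)/l` modulo `n/l`, let `j' ≡ j (mod n/l)`, and let `z < n/l` be the residue of
`−j'·r` modulo `n/l`. Then, whenever the `j`-th staircase is nonempty, `n` divides
`(m−1)·z + j·l` and the first stair on the `j`-th staircase is
`(((m−1)·z + j·l)/n, z) = (((m−1)/n)·z + j·(l/n), z)`. -/
theorem first_stair_coordinates (n m : ℕ) (hn : 0 < n) (hm : 2 ≤ m)
    (hco : Nat.Coprime n m) (hdvd : n ∣ (m - 1) ^ 2)
    (r : ℕ) (hr : ((m - 1) / Nat.gcd n (m - 1)) * r ≡ 1 [MOD n / Nat.gcd n (m - 1)])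
    (j j' z : ℕ) (hj' : j' ≡ j [MOD n / Nat.gcd n (m - 1)])
    (hz : z < n / Nat.gcd n (m - 1))
    (hzres : j' * r + z ≡ 0 [MOD n / Nat.gcd n (m - 1)])
    (hne : (staircase (n : ℤ) (m : ℤ) j).Nonempty) :
    (n : ℤ) ∣ (((m : ℤ) - 1) * (z : ℤ) + (j : ℤ) * (Nat.gcd n (m - 1) : ℤ)) ∧
    IsFirstStair (n : ℤ) (m : ℤ) j
      ((((m : ℤ) - 1) * (z : ℤ) + (j : ℤ) * (Nat.gcd n (m - 1) : ℤ)) / (n : ℤ),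
        (z : ℤ)) := by
  obtain ⟨k, rfl⟩ : ∃ k, m = k + 1 := ⟨m - 1, by omega⟩
  have hk : ((k + 1 : ℕ) : ℤ) - 1 = (k : ℤ) := by push_cast; ring
  simp only [Nat.add_sub_cancel] at *
  have hg : Int.gcd (n : ℤ) (k : ℤ) = Nat.gcd n k := Int.gcd_natCast_natCast n k
  have hl : 0 < Nat.gcd n k := Nat.gcd_pos_of_pos_left _ hn
  have hna : n = Nat.gcd n k * (n / Nat.gcd n k) :=
    (Nat.mul_div_cancel' (Nat.gcd_dvd_left n k)).symm
  have hkb : k = Nat.gcd n k * (k / Nat.gcd n k) :=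
    (Nat.mul_div_cancel' (Nat.gcd_dvd_right n k)).symm
  unfold IsFirstStair
  simp only [staircase, sectorLattice, Set.mem_setOf_eq, hk, hg] at *
  generalize Nat.gcd n k = l at *
  generalize n / l = a at *
  generalize k / l = b at *
  have hlz : (l : ℤ) ≠ 0 := by exact_mod_cast hl.ne'
  have hnz : (0 : ℤ) < n := by exact_mod_cast hn
  have hna' : (n : ℤ) = l * a := by exact_mod_cast hna
  have hkb' : (k : ℤ) = l * b := by exact_mod_cast hkb
  obtain ⟨c1, h1⟩ := (Nat.modEq_iff_dvd.mp hr)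
  obtain ⟨c2, h2⟩ := (Nat.modEq_iff_dvd.mp hj')
  obtain ⟨c3, h3⟩ := (Nat.modEq_iff_dvd.mp hzres)
  push_cast at h1 h2 h3
  -- key divisibility
  have hx : (b : ℤ) * z + j = a * (c2 - b * c3 + j' * c1) := by
    linear_combination h2 - (b : ℤ) * h3 + (j' : ℤ) * h1
  have hX : (k : ℤ) * z + j * l = n * (c2 - b * c3 + j' * c1) := by
    rw [hna', hkb']; linear_combination (l : ℤ) * hx
  have key : ∀ X Y : ℤ, 0 ≤ Y → (k : ℤ) * Y = n * X - j * l → (z : ℤ) ≤ Y := by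
    intro X Y hY h
    have e1 : (b : ℤ) * Y + j = a * X := by
      apply mul_left_cancel₀ hlz
      rw [hna', hkb'] at h
      linear_combination h
    have e2 : (a : ℤ) ∣ Y - z :=
      ⟨c1 * (Y - z) + r * (X - (c2 - b * c3 + j' * c1)), by
        linear_combination (Y - z) * h1 + (r : ℤ) * (e1 - hx)⟩
    obtain ⟨t, ht⟩ := e2
    have hza : (z : ℤ) < a := by exact_mod_cast hz
    by_contra hlt
    push Not at hlt
    have : t < 0 := by
      by_contra h0
      push Not at h0
      nlinarith
    nlinarith
  rw [hX, Int.mul_ediv_cancel_left _ hnz.ne']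
  generalize (c2 - b * c3 + j' * c1 : ℤ) = x at *
  have hk0 : (0 : ℤ) ≤ k := by positivity
  have hz0 : (0 : ℤ) ≤ z := by positivity
  refine ⟨Dvd.intro _ rfl, ⟨⟨?_, hz0, ?_⟩, by linear_combination hX⟩, ?_⟩
  · have : (0 : ℤ) ≤ n * x := by rw [← hX]; positivity
    exact nonneg_of_mul_nonneg_right this hnz
  · obtain ⟨⟨X, Y⟩, ⟨h0, h1', h2'⟩, h3'⟩ := hne
    have := key X Y h1' h3'
    push_cast at h2' ⊢
    dsimp only at h2' h3'
    linarith
  · rintro ⟨X, Y⟩ ⟨⟨h0, h1', h2'⟩, h3'⟩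
    have := key X Y h1' h3'
    dsimp only at h3' ⊢
    have : (n : ℤ) * x ≤ n * X := by nlinarith
    exact le_of_mul_le_mul_left this hnz
end

section
/- Let m, n be coprime positive integers with m ≥ 2 and n dividing (m−1)², and set l = gcd(n, m−1). Suppose p(x,y) = (n/2)(x − ((m−1)/n)y)² + dx + ey + f is a packing polynomial on S(n/m). Then exactly one of the following holds: (1) p is an ascending k-stair polynomial for some k with k ≡ (m−1)/l (mod n/l), and p(x,y) = (n/2)(x − ((m−1)/n)y)² + (1 − kl/2)x + ((2(1−m) + kl(m+1))/(2n))y + f; or (2) p is a descending k-stair polynomial for some k with k ≡ −(m−1)/l (mod n/l), and p(x,y) = (n/2)(x − ((m−1)/n)y)² + (1 + kl/2)x + ((2(1−m) − kl(m+1))/(2n))y + f. -/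
lemma arith_large (T K : ℤ) (hT : 1 ≤ T) (h f : ℝ) :
    ∃ C0 : ℤ, ∀ c : ℤ, C0 ≤ c →
      (∀ θ : ℝ, 0 ≤ θ → θ ≤ 1 →
        0 ≤ (T : ℝ) / 2 * c ^ 2 + h * c + K * (T * c - θ) + K + f) ∧
      (∀ (c' : ℤ) (θ η : ℝ), 0 ≤ c' → 0 ≤ θ → θ ≤ 1 → 0 ≤ η → η ≤ 1 →
        (T : ℝ) / 2 * c' ^ 2 + h * c' + K * η + f
          = (T : ℝ) / 2 * c ^ 2 + h * c + K * (T * c - θ) + K + f → c' = c + K) := by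
  have hT' : (1 : ℝ) ≤ T := by exact_mod_cast hT
  obtain ⟨C1, hC1⟩ := exists_int_gt
    (2 * (|h| + |(K : ℝ)| * T + 2 * |(K : ℝ)| + |f|) + 1)
  obtain ⟨C2, hC2⟩ := exists_int_gt
    (2 * (|h| + 4 * |(K : ℝ)| + T * K ^ 2 / 2 + |h * K|) + |(K : ℝ)| + 1)
  have a1 := abs_nonneg h
  have a2 := abs_nonneg (K : ℝ)
  have a3 := abs_nonneg f
  have a4 := neg_abs_le h
  have a5 := neg_abs_le (K : ℝ)
  have a6 := neg_abs_le f
  have a7 := le_abs_self (K : ℝ)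
  have a8 := neg_abs_le (h * K)
  have a9 := le_abs_self (h * K)
  have aK : 0 ≤ |(K : ℝ)| * T := by positivity
  refine ⟨max C1 C2, fun c hc => ⟨?_, ?_⟩⟩
  · intro θ h0 h1
    have hc1 : (C1 : ℝ) ≤ c := by exact_mod_cast (le_max_left _ _).trans hc
    have b1 : -(|(K : ℝ)|) ≤ -(K * θ) := by
      have : K * θ ≤ |(K : ℝ)| * 1 :=
        mul_le_mul a7 h1 h0 a2
      linarith
    have b2 : -(|(K : ℝ)| * T) ≤ K * T := by nlinarith
    have hcpos : (1 : ℝ) ≤ c := by linarith [abs_nonneg f]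
    have b3 : 2 * |(K : ℝ)| + |f| ≤ (T : ℝ) / 2 * c + h + K * T := by nlinarith
    have b4 : 2 * |(K : ℝ)| + |f| ≤ c * ((T : ℝ) / 2 * c + h + K * T) := by nlinarith
    nlinarith
  · intro c' θ η hc' h0 h1 g0 g1 heq
    have hc2 : (C2 : ℝ) ≤ c := by exact_mod_cast (le_max_right _ _).trans hc
    have hc'' : (0 : ℝ) ≤ c' := by exact_mod_cast hc'
    have key : ((c' : ℝ) - (c + K)) * ((T : ℝ) / 2 * (c' + (c + K)) + h)
        = K * (1 - θ - η) - T * K ^ 2 / 2 - h * K := by linear_combination heq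
    have habs : |(K : ℝ) * (1 - θ - η)| ≤ |(K : ℝ)| := by
      rw [abs_mul]
      have : |1 - θ - η| ≤ 1 := abs_le.2 ⟨by linarith, by linarith⟩
      nlinarith
    have hb := abs_le.1 habs
    have hTK : 0 ≤ (T : ℝ) * K ^ 2 / 2 := by positivity
    have hpos : |(K : ℝ)| + T * K ^ 2 / 2 + |h * K| < (T : ℝ) / 2 * (c' + (c + K)) + h := by
      have : 0 ≤ (c' : ℝ) + (c + K) := by
        have := abs_nonneg (h * K)
        linarith
      have := abs_nonneg (h * K)
      nlinarith
    have hkpos : 0 ≤ |h * K| := abs_nonneg _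
    by_contra hne
    rcases lt_or_gt_of_ne hne with hlt | hgt
    · have : (c' : ℝ) + 1 ≤ c + K := by exact_mod_cast hlt
      nlinarith
    · have : (c : ℝ) + K + 1 ≤ c' := by exact_mod_cast hgt
      nlinarith

/-- The core of the argument, in terms of `n = N²T`, `m = NTM + 1`. -/
lemma core (N T M : ℤ) (hN : 1 ≤ N) (hT : 1 ≤ T) (hM : 1 ≤ M) (d e f : ℝ)
    (p : ℝ → ℝ → ℝ)
    (hp : ∀ x y : ℝ, p x y = (T : ℝ) / 2 * (N * x - M * y) ^ 2 + d * x + e * y + f)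
    (S : ℤ → ℤ → Prop)
    (hS : ∀ x y, S x y ↔ (0 ≤ x ∧ 0 ≤ y ∧ y ≤ N * T * (N * x - M * y)))
    (h1 : ∀ x y, S x y → ∃ j : ℕ, p x y = j)
    (h2 : ∀ x y x' y' : ℤ, S x y → S x' y' → p x y = p x' y' → x = x' ∧ y = y')
    (h3 : ∀ j : ℕ, ∃ x y : ℤ, S x y ∧ p x y = j) :
    ∃ K : ℤ, K ≠ 0 ∧ (K : ℝ) = d * M + e * N ∧ d = 1 - K * (N * T) / 2 ∧
      ∃ z : ℤ, K = M + N * z := by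
  have hstep : ∀ x y : ℝ, p (x + M) (y + N) = p x y + (d * M + e * N) := by
    intro x y; rw [hp, hp]; ring
  have s1 : S 1 0 := by rw [hS]; refine ⟨by norm_num, le_refl _, ?_⟩; simp; positivity
  have s2 : S (1 + M) (0 + N) := by
    rw [hS]; refine ⟨by positivity, by positivity, ?_⟩
    have : 1 ≤ N * T := one_le_mul_of_one_le_of_one_le hN hT
    nlinarith
  obtain ⟨j1, hj1⟩ := h1 _ _ s1
  obtain ⟨j2, hj2⟩ := h1 _ _ s2
  have hK : (((j2 : ℤ) - j1 : ℤ) : ℝ) = d * M + e * N := by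
    have := hstep 1 0
    push_cast at hj1 hj2 ⊢
    rw [← hj1, ← hj2, this]; ring
  generalize (j2 : ℤ) - j1 = K at hK
  have hK0 : K ≠ 0 := by
    rintro rfl
    have h := hstep 1 0
    rw [← hK] at h
    have := h2 _ _ _ _ s2 s1 (by push_cast at h ⊢; simpa using h)
    omega
  have hNr : (1 : ℝ) ≤ N := by exact_mod_cast hN
  have hNne : (N : ℝ) ≠ 0 := by positivity
  have hform : ∀ x y : ℝ, p x y = (T : ℝ) / 2 * (N * x - M * y) ^ 2 +
      d / N * (N * x - M * y) + K * (y / N) + f := by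
    intro x y; rw [hp, hK]; field_simp; ring
  obtain ⟨C0, hC0⟩ := arith_large T K hT (d / N) f
  have main : ∀ c x y δ : ℤ, C0 ≤ c → N ≤ c → N * x - M * y = c → y = N * T * c - δ →
      0 ≤ δ → δ < N → ∃ x' y' : ℤ, 0 ≤ y' ∧ y' < N ∧ N * x' - M * y' = c + K ∧
        (N : ℝ) - δ - y' = N * T * K / 2 + d := by
    intro c x y δ hc hcN hxy hy hδ0 hδ
    have hNT : 1 ≤ N * T := one_le_mul_of_one_le_of_one_le hN hT
    have hy0 : 0 ≤ y := by nlinarith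
    have hx0 : 0 ≤ x := by
      have : 0 ≤ N * x := by nlinarith
      nlinarith
    have hSr : S x y := by rw [hS, hxy]; exact ⟨hx0, hy0, by omega⟩
    have hSn : ¬ S (x + M) (y + N) := by
      rw [hS]; rintro ⟨-, -, h⟩
      have : N * (x + M) - M * (y + N) = c := by rw [← hxy]; ring
      rw [this] at h; omega
    obtain ⟨g1, g2⟩ := hC0 c hc
    have hxyr : (N : ℝ) * x - M * y = c := by exact_mod_cast hxy
    have hyr : (y : ℝ) / N = T * c - δ / N := by
      rw [hy]; push_cast; field_simp
    have hδr0 : (0 : ℝ) ≤ (δ : ℝ) / N := by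
      have : (0 : ℝ) ≤ δ := by exact_mod_cast hδ0
      positivity
    have hδr1 : (δ : ℝ) / N ≤ 1 := by
      rw [div_le_one (by positivity)]; exact_mod_cast hδ.le
    have hv := g1 _ hδr0 hδr1
    have hpv : p x y + K = (T : ℝ) / 2 * c ^ 2 + d / N * c + K * (T * c - δ / N) + K + f := by
      rw [hform, hxyr, hyr]; ring
    obtain ⟨i, hi⟩ := h1 _ _ hSr
    have hz : 0 ≤ (i : ℤ) + K := by
      have : (0 : ℝ) ≤ (i : ℝ) + K := by rw [← hi, hpv]; exact hv
      exact_mod_cast this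
    obtain ⟨x', y', hS', hp'⟩ := h3 ((i : ℤ) + K).toNat
    have hcast : ((((i : ℤ) + K).toNat : ℕ) : ℝ) = (i : ℝ) + K := by
      have : ((((i : ℤ) + K).toNat : ℕ) : ℤ) = (i : ℤ) + K := Int.toNat_of_nonneg hz
      exact_mod_cast this
    rw [hcast, ← hi] at hp'
    have hS'' := (hS _ _).1 hS'
    obtain ⟨q1, q2, q3⟩ := hS''
    have hc'0 : 0 ≤ N * x' - M * y' := by
      by_contra hneg
      push Not at hneg
      nlinarith
    have hy'N : y' < N := by
      by_contra hge
      push Not at hge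
      have hSm : S (x' - M) (y' - N) := by
        rw [hS]
        refine ⟨?_, by omega, ?_⟩
        · have : 0 ≤ N * (x' - M) := by nlinarith
          nlinarith
        · have : N * (x' - M) - M * (y' - N) = N * x' - M * y' := by ring
          rw [this]; omega
      have hh := hstep (x' - M) (y' - N)
      rw [← hK, sub_add_cancel, sub_add_cancel, hp'] at hh
      have := h2 _ _ _ _ hSm hSr (by push_cast; linarith)
      apply hSn
      have e1 : x + M = x' := by omega
      have e2 : y + N = y' := by omega
      rw [e1, e2]; exact hS'
    have hη0 : (0 : ℝ) ≤ (y' : ℝ) / N := by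
      have : (0 : ℝ) ≤ y' := by exact_mod_cast q2
      positivity
    have hη1 : (y' : ℝ) / N ≤ 1 := by
      rw [div_le_one (by positivity)]; exact_mod_cast hy'N.le
    have heq : (T : ℝ) / 2 * ((N * x' - M * y' : ℤ) : ℝ) ^ 2
        + d / N * ((N * x' - M * y' : ℤ) : ℝ) + K * (y' / N) + f
        = (T : ℝ) / 2 * c ^ 2 + d / N * c + K * (T * c - δ / N) + K + f := by
      rw [← hpv, ← hp', hform]; push_cast; ring
    have hcc := g2 _ _ _ hc'0 hδr0 hδr1 hη0 hη1 heq
    refine ⟨x', y', q2, hy'N, hcc, ?_⟩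
    rw [hcc] at heq
    push_cast at heq
    have hKr : (K : ℝ) ≠ 0 := by exact_mod_cast hK0
    apply mul_left_cancel₀ hKr
    field_simp at heq
    linear_combination (-1 / 2 : ℝ) * heq
  have hJ : ∃ j : ℤ, C0 ≤ N * j - M ∧ N ≤ N * j - M ∧ C0 ≤ N * j ∧ N ≤ N * j := by
    refine ⟨|C0| + M + N, ?_⟩
    have := le_abs_self C0
    have := abs_nonneg C0
    refine ⟨?_, ?_, ?_, ?_⟩ <;> nlinarith
  obtain ⟨j, u1, u2, u3, u4⟩ := hJ
  obtain ⟨x1, y1, v1, v2, v3, v4⟩ := main (N * j) ((N * T * M + 1) * j) (N * N * T * j) 0 u3 u4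
    (by ring) (by ring) le_rfl (by omega)
  obtain ⟨x2, y2, w1, w2, w3, w4⟩ := main (N * j - M) ((N * T * M + 1) * j - M - T * M ^ 2)
    (N * T * (N * j - M) - (N - 1)) (N - 1) u1 u2 (by ring) rfl (by omega) (by omega)
  have hyy : (N : ℤ) - y1 = 1 - y2 := by
    have : (N : ℝ) - y1 = 1 - y2 := by push_cast at v4 w4; linarith
    exact_mod_cast this
  have hy1 : y1 = N - 1 := by omega
  refine ⟨K, hK0, hK, ?_, x1 - M - j, ?_⟩
  · rw [hy1] at v4; push_cast at v4; linarith
  · rw [hy1] at v3; linear_combination -v3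

lemma intValued_of_sector (N T M : ℤ) (hN : 1 ≤ N) (hT : 1 ≤ T) (hM : 1 ≤ M) (d e f : ℝ)
    (p : ℝ → ℝ → ℝ)
    (hp : ∀ x y : ℝ, p x y = (T : ℝ) / 2 * (N * x - M * y) ^ 2 + d * x + e * y + f)
    (S : ℤ → ℤ → Prop)
    (hS : ∀ x y, S x y ↔ (0 ≤ x ∧ 0 ≤ y ∧ y ≤ N * T * (N * x - M * y)))
    (h1 : ∀ x y, S x y → ∃ j : ℕ, p x y = j) : IntValued p := by
  intro a b
  have hNT : 1 ≤ N * T := one_le_mul_of_one_le_of_one_le hN hT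
  obtain ⟨D, hD1, hD2, hD3⟩ : ∃ D : ℤ, 0 ≤ a + D ∧ 0 ≤ b + D ∧
      b ≤ N * T * (N * a - M * b) + D :=
    ⟨|a| + |b| + |N * T * (N * a - M * b)|, by
      have := neg_abs_le a; have := abs_nonneg b
      have := abs_nonneg (N * T * (N * a - M * b)); omega, by
      have := neg_abs_le b; have := abs_nonneg a
      have := abs_nonneg (N * T * (N * a - M * b)); omega, by
      have := le_abs_self b; have := abs_nonneg a
      have := neg_abs_le (N * T * (N * a - M * b)); omega⟩
  -- enlarge the translation so that it is non-negative
  have hs : ∀ i : ℤ, 1 ≤ i → S (a + i * (|D| * (M + 2))) (b + i * |D|) := by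
    intro i hi
    have hDa := le_abs_self D
    have hD0 := abs_nonneg D
    have hiD : D ≤ i * |D| := by nlinarith
    have hiD0 : 0 ≤ i * |D| := by positivity
    rw [hS]
    refine ⟨by nlinarith, by omega, ?_⟩
    have e1 : N * T * (N * (a + i * (|D| * (M + 2))) - M * (b + i * |D|))
        = N * T * (N * a - M * b) + N * T * (i * |D|) * (N * (M + 2) - M) := by ring
    rw [e1]
    have : 2 ≤ N * (M + 2) - M := by nlinarith
    have h4 : i * |D| ≤ N * T * (i * |D|) := by nlinarith
    nlinarith
  obtain ⟨z1, k1⟩ := h1 _ _ (hs 1 (by norm_num))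
  obtain ⟨z2, k2⟩ := h1 _ _ (hs 2 (by norm_num))
  obtain ⟨z3, k3⟩ := h1 _ _ (hs 3 (by norm_num))
  refine ⟨3 * z1 - 3 * z2 + z3, ?_⟩
  push_cast at k1 k2 k3 ⊢
  rw [← k1, ← k2, ← k3, hp, hp, hp, hp]
  ring

lemma consec (N T M n m : ℤ) (hN : 1 ≤ N) (hT : 1 ≤ T) (hM : 1 ≤ M) (hc : IsCoprime N M)
    (hS : ∀ P, P ∈ sectorLattice n m ↔
      (0 ≤ P.1 ∧ 0 ≤ P.2 ∧ P.2 ≤ N * T * (N * P.1 - M * P.2)))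
    (hst : ∀ c P, P ∈ staircase n m c ↔ (P ∈ sectorLattice n m ∧ N * P.1 - M * P.2 = c))
    (r s : ℤ × ℤ) (h : ConsecutiveStairs n m r s) :
    (s.1 = r.1 + M ∧ s.2 = r.2 + N) ∨ (r.1 = s.1 + M ∧ r.2 = s.2 + N) := by
  have aux : ∀ r s : ℤ × ℤ, r.1 ≤ s.1 → ConsecutiveStairs n m r s →
      (s.1 = r.1 + M ∧ s.2 = r.2 + N) := by
    rintro ⟨a, b⟩ ⟨a', b'⟩ hle ⟨c, hr, hs, hne, hno⟩
    rw [hst, hS] at hr hs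
    simp only at hr hs hle ⊢
    obtain ⟨⟨r1, r2, r3⟩, r4⟩ := hr
    obtain ⟨⟨s1, s2, s3⟩, s4⟩ := hs
    have e1 : N * (a' - a) = M * (b' - b) := by linear_combination s4 - r4
    obtain ⟨q, hq⟩ : N ∣ b' - b := hc.dvd_of_dvd_mul_left ⟨a' - a, e1.symm⟩
    have hq' : a' - a = M * q := by
      have hN0 : N ≠ 0 := by omega
      apply mul_left_cancel₀ hN0
      rw [e1, hq]; ring
    have hq0 : 0 ≤ q := by
      by_contra hneg; push Not at hneg; nlinarith
    have hqne : q ≠ 0 := by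
      rintro rfl
      apply hne
      simp only [mul_zero] at hq hq'
      ext <;> simp <;> omega
    have hq2 : q < 2 := by
      by_contra hge
      push Not at hge
      apply hno (a + M, b + N)
      · rw [hst, hS]
        simp only
        have e2 : N * (a + M) - M * (b + N) = c := by rw [← r4]; ring
        refine ⟨⟨by omega, by omega, ?_⟩, e2⟩
        rw [e2]; rw [s4] at s3; nlinarith
      · simp only [min_eq_left hle, max_eq_right hle]
        constructor
        · omega
        · nlinarith
    have : q = 1 := by omega
    subst this
    constructor <;> linarith
  rcases le_total r.1 s.1 with hle | hle
  · exact Or.inl (aux r s hle h)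
  · right
    apply aux s r hle
    obtain ⟨c, hr, hs, hne, hno⟩ := h
    exact ⟨c, hs, hr, hne.symm, by simpa only [min_comm, max_comm] using hno⟩

/-- If `p(x,y) = (n/2)(x − ((m−1)/n)y)² + dx + ey + f` is a packing
polynomial on `S(n/m)`, then exactly one of the following holds (`l = gcd(n, m−1)`):
(1) `p` is an ascending `k`-stair polynomial with `k ≡ (m−1)/l (mod n/l)` and
`p(x,y) = (n/2)(x − ((m−1)/n)y)² + (1 − kl/2)x + ((2(1−m) + kl(m+1))/(2n))y + f`; or
(2) `p` is a descending `k`-stair polynomial with `k ≡ −(m−1)/l (mod n/l)` and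
`p(x,y) = (n/2)(x − ((m−1)/n)y)² + (1 + kl/2)x + ((2(1−m) − kl(m+1))/(2n))y + f`. -/
theorem necessary_form (n m : ℕ) (hn : 0 < n) (hm : 2 ≤ m)
    (hco : Nat.Coprime n m) (hdvd : n ∣ (m - 1) ^ 2)
    (d e f : ℝ) (p : ℝ → ℝ → ℝ)
    (hp : ∀ x y : ℝ, p x y =
      (n : ℝ) / 2 * (x - ((m : ℝ) - 1) / (n : ℝ) * y) ^ 2 + d * x + e * y + f)
    (hpack : IsPackingPolyOn p (sectorLattice (n : ℤ) (m : ℤ))) :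
    Xor'
      (∃ k : ℕ, IsAscendingKStair (n : ℤ) (m : ℤ) k p ∧
        (k : ℤ) ≡ ((m : ℤ) - 1) / (Nat.gcd n (m - 1) : ℤ)
          [ZMOD (n : ℤ) / (Nat.gcd n (m - 1) : ℤ)] ∧
        ∀ x y : ℝ, p x y =
          (n : ℝ) / 2 * (x - ((m : ℝ) - 1) / (n : ℝ) * y) ^ 2 +
            (1 - (k : ℝ) * (Nat.gcd n (m - 1) : ℝ) / 2) * x +
            ((2 * (1 - (m : ℝ)) + (k : ℝ) * (Nat.gcd n (m - 1) : ℝ) * ((m : ℝ) + 1)) /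
              (2 * (n : ℝ))) * y + f)
      (∃ k : ℕ, IsDescendingKStair (n : ℤ) (m : ℤ) k p ∧
        (k : ℤ) ≡ -(((m : ℤ) - 1) / (Nat.gcd n (m - 1) : ℤ))
          [ZMOD (n : ℤ) / (Nat.gcd n (m - 1) : ℤ)] ∧
        ∀ x y : ℝ, p x y =
          (n : ℝ) / 2 * (x - ((m : ℝ) - 1) / (n : ℝ) * y) ^ 2 +
            (1 + (k : ℝ) * (Nat.gcd n (m - 1) : ℝ) / 2) * x +
            ((2 * (1 - (m : ℝ)) - (k : ℝ) * (Nat.gcd n (m - 1) : ℝ) * ((m : ℝ) + 1)) /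
              (2 * (n : ℝ))) * y + f) := by
  obtain ⟨m', rfl⟩ : ∃ m', m = m' + 1 := ⟨m - 1, by omega⟩
  simp only [Nat.add_sub_cancel] at *
  obtain ⟨N, M, hcop, hnN, hmM⟩ := Nat.exists_coprime n m'
  have hgpos : 0 < Nat.gcd n m' := Nat.gcd_pos_of_pos_left _ hn
  have hintgcd : (Int.gcd (n : ℤ) ((m' + 1 : ℕ) - 1 : ℤ) : ℤ) = (Nat.gcd n m' : ℤ) := by
    push_cast
    rw [add_sub_cancel_right, Int.gcd_natCast_natCast]
  generalize Nat.gcd n m' = L at *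
  obtain ⟨T, hT⟩ : N ∣ L := by
    rw [hnN, hmM] at hdvd
    have h1 : N * L ∣ (M ^ 2 * L) * L := by convert hdvd using 1; ring
    have h2 := Nat.dvd_of_mul_dvd_mul_right hgpos h1
    exact (hcop.pow_right 2).dvd_of_dvd_mul_left h2
  have hLN : 0 < N := by
    rcases Nat.eq_zero_or_pos N with h | h
    · subst h; simp at hnN; omega
    · exact h
  have hM0 : 0 < M := by
    rcases Nat.eq_zero_or_pos M with h | h
    · subst h; simp at hmM; omega
    · exact h
  have hT0 : 0 < T := by
    rcases Nat.eq_zero_or_pos T with h | h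
    · subst h; simp at hT; omega
    · exact h
  subst hT
  subst hnN
  subst hmM
  have hNz : (1 : ℤ) ≤ N := by exact_mod_cast hLN
  have hTz : (1 : ℤ) ≤ T := by exact_mod_cast hT0
  have hMz : (1 : ℤ) ≤ M := by exact_mod_cast hM0
  have hNr : (N : ℝ) ≠ 0 := by positivity
  have hTr : (T : ℝ) ≠ 0 := by positivity
  have hS : ∀ P, P ∈ sectorLattice ((N * (N * T) : ℕ) : ℤ) ((M * (N * T) + 1 : ℕ) : ℤ) ↔
      (0 ≤ P.1 ∧ 0 ≤ P.2 ∧ P.2 ≤ (N : ℤ) * T * (N * P.1 - M * P.2)) := by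
    intro P
    simp only [sectorLattice, Set.mem_setOf_eq]
    push_cast
    refine and_congr_right fun _ => and_congr_right fun _ => ?_
    constructor <;> intro h <;> linarith
  have hst : ∀ c P, P ∈ staircase ((N * (N * T) : ℕ) : ℤ) ((M * (N * T) + 1 : ℕ) : ℤ) c ↔
      (P ∈ sectorLattice ((N * (N * T) : ℕ) : ℤ) ((M * (N * T) + 1 : ℕ) : ℤ) ∧
        (N : ℤ) * P.1 - M * P.2 = c) := by
    intro c P
    simp only [staircase, Set.mem_setOf_eq]
    rw [hintgcd]
    refine and_congr_right fun _ => ?_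
    push_cast
    have hne : (N : ℤ) * T ≠ 0 := by positivity
    constructor
    · intro h
      apply mul_left_cancel₀ hne
      linear_combination -h
    · intro h
      linear_combination (-(N : ℤ) * T) * h
  have hp' : ∀ x y : ℝ, p x y =
      ((T : ℤ) : ℝ) / 2 * (((N : ℤ) : ℝ) * x - ((M : ℤ) : ℝ) * y) ^ 2 + d * x + e * y + f := by
    intro x y
    rw [hp]
    push_cast
    field_simp
    ring
  obtain ⟨pk1, pk2, pk3⟩ := hpack
  have hS' : ∀ x y : ℤ, (x, y) ∈ sectorLattice ((N * (N * T) : ℕ) : ℤ)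
      ((M * (N * T) + 1 : ℕ) : ℤ) ↔
      (0 ≤ x ∧ 0 ≤ y ∧ y ≤ (N : ℤ) * T * (N * x - M * y)) := fun x y => hS (x, y)
  obtain ⟨K, hK0, hK, hd, z, hz⟩ := core N T M hNz hTz hMz d e f p hp' _ hS'
    (fun x y h => pk1 (x, y) h)
    (fun x y x' y' h h' heq => Prod.ext_iff.1 (pk2 h h' heq))
    (fun j => by obtain ⟨P, hP, h⟩ := pk3 j; exact ⟨P.1, P.2, hP, h⟩)
  have hintval := intValued_of_sector N T M hNz hTz hMz d e f p hp' _ hS' (fun x y h => pk1 (x, y) h)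
  have hquad : HasQuadPart ((N * (N * T) : ℕ) : ℤ) ((M * (N * T) + 1 : ℕ) : ℤ) p :=
    ⟨d, e, f, fun x y => by rw [hp]; simp only [Int.cast_natCast]⟩
  have hcons := consec N T M _ _ hNz hTz hMz (Nat.isCoprime_iff_coprime.2 hcop) hS hst
  have hstep : ∀ r s : ℤ × ℤ, s.1 = r.1 + M → s.2 = r.2 + N →
      p s.1 s.2 - p r.1 r.2 = K := by
    intro r s e1 e2
    rw [hp', hp', e1, e2, hK]; push_cast; ring
  have hmem : ∀ r s : ℤ × ℤ, ConsecutiveStairs ((N * (N * T) : ℕ) : ℤ)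
      ((M * (N * T) + 1 : ℕ) : ℤ) r s → r.1 ^ 2 + r.2 ^ 2 < s.1 ^ 2 + s.2 ^ 2 →
      p s.1 s.2 - p r.1 r.2 = K := by
    intro r s h hlt
    rcases hcons r s h with ⟨e1, e2⟩ | ⟨e1, e2⟩
    · exact hstep r s e1 e2
    · exfalso
      obtain ⟨c, -, hs, -⟩ := h
      have := (hS _).1 ((hst _ _).1 hs).1
      rw [e1, e2] at hlt
      nlinarith
  have hdiv1 : (((M * (N * T) + 1 : ℕ) : ℤ) - 1) / ((N * T : ℕ) : ℤ) = M := by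
    push_cast
    rw [add_sub_cancel_right]
    exact Int.mul_ediv_cancel _ (by positivity)
  have hdiv2 : ((N * (N * T) : ℕ) : ℤ) / ((N * T : ℕ) : ℤ) = N := by
    push_cast
    exact Int.mul_ediv_cancel _ (by positivity)
  rw [hdiv1, hdiv2]
  have hpf : ∀ x y : ℝ, p x y =
      ((N * (N * T) : ℕ) : ℝ) / 2 *
        (x - (((M * (N * T) + 1 : ℕ) : ℝ) - 1) / ((N * (N * T) : ℕ) : ℝ) * y) ^ 2 +
      (1 - (K : ℝ) * ((N * T : ℕ) : ℝ) / 2) * x +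
      ((2 * (1 - ((M * (N * T) + 1 : ℕ) : ℝ)) +
        (K : ℝ) * ((N * T : ℕ) : ℝ) * (((M * (N * T) + 1 : ℕ) : ℝ) + 1)) /
              (2 * ((N * (N * T) : ℕ) : ℝ))) * y + f := by
    have he : e = (2 * (1 - ((M * (N * T) + 1 : ℕ) : ℝ)) +
        (K : ℝ) * ((N * T : ℕ) : ℝ) * (((M * (N * T) + 1 : ℕ) : ℝ) + 1)) /
              (2 * ((N * (N * T) : ℕ) : ℝ)) := by
      have he' : e = (K - d * M) / N := by
        rw [hK]; push_cast; field_simp; ring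
      rw [he', hd]
      push_cast
      field_simp
      ring
    intro x y
    rw [hp, ← he, hd]
    push_cast
    ring
  have hdeq : ∀ D E : ℝ, (∀ x y : ℝ, p x y = ((N * (N * T) : ℕ) : ℝ) / 2 *
        (x - (((M * (N * T) + 1 : ℕ) : ℝ) - 1) / ((N * (N * T) : ℕ) : ℝ) * y) ^ 2 +
      D * x + E * y + f) → D = 1 - (K : ℝ) * (N * T) / 2 := by
    intro D E h
    have h1 := h 1 0
    rw [hp, hd] at h1
    push_cast at h1
    linarith
  have hNTr : (0 : ℝ) < N * T := by positivity
  rcases lt_or_gt_of_ne hK0 with hneg | hpos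
  · right
    obtain ⟨k, hk⟩ : ∃ k : ℕ, K = -(k : ℤ) := ⟨(-K).toNat, by omega⟩
    have hkr : (K : ℝ) = -(k : ℝ) := by rw [hk]; push_cast; ring
    refine ⟨⟨k, ⟨⟨hquad, hintval, ?_⟩, ?_⟩, ?_, ?_⟩, ?_⟩
    · intro r s h
      rcases hcons r s h with ⟨e1, e2⟩ | ⟨e1, e2⟩
      · left; have := hstep r s e1 e2; linarith
      · right; have := hstep s r e1 e2; linarith
    · intro r s h hlt
      rw [hmem r s h hlt, hkr]
    · rw [Int.modEq_iff_dvd]; exact ⟨z, by linear_combination hz - hk⟩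
    · intro x y
      rw [hpf, hkr]; ring
    · rintro ⟨k', -, -, h⟩
      have := hdeq _ _ h
      push_cast at this
      have h3 : ((k' : ℝ) + k) * (N * T) = 0 := by rw [hkr] at this; linarith
      have h4 : (0 : ℝ) < k := by
        have : 0 < k := by omega
        exact_mod_cast this
      have : (0 : ℝ) < ((k' : ℝ) + k) * (N * T) := by positivity
      linarith
  · left
    obtain ⟨k, hk⟩ : ∃ k : ℕ, K = (k : ℤ) := ⟨K.toNat, by omega⟩
    have hkr : (K : ℝ) = (k : ℝ) := by rw [hk]; push_cast; ring
    refine ⟨⟨k, ⟨⟨hquad, hintval, ?_⟩, ?_⟩, ?_, ?_⟩, ?_⟩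
    · intro r s h
      rcases hcons r s h with ⟨e1, e2⟩ | ⟨e1, e2⟩
      · right; have := hstep r s e1 e2; linarith
      · left; have := hstep s r e1 e2; linarith
    · intro r s h hlt
      rw [hmem r s h hlt, hkr]
    · rw [Int.modEq_iff_dvd]; exact ⟨-z, by linear_combination -hz + hk⟩
    · intro x y
      rw [hpf, hkr]
    · rintro ⟨k', -, -, h⟩
      have := hdeq _ _ h
      push_cast at this
      have h3 : ((k' : ℝ) + k) * (N * T) = 0 := by rw [hkr] at this; linarith
      have h4 : (0 : ℝ) < k := by
        have : 0 < k := by omega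
        exact_mod_cast this
      have : (0 : ℝ) < ((k' : ℝ) + k) * (N * T) := by positivity
      linarith
end

section
/- Let m, n be coprime positive integers with m ≥ 2 and n dividing (m−1)², set l = gcd(n, m−1), let k ≥ 1, and let a₁, …, a_k be the first stairs on the staircases S_0, S_1, …, S_{k−1} of S(n/m). Then a quadratic polynomial p is an ascending packing polynomial on S(n/m) if and only if p is an ascending k-stair polynomial of the form p(x,y) = (n/2)(x − ((m−1)/n)y)² + (1 − kl/2)x + ((2(1−m) + kl(m+1))/(2n))y + f with k ≡ (m−1)/l (mod n/l), and {p(a₁), …, p(a_k)} = {0, 1, …, k−1}. -/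
/-- Membership in the sector in reduced coordinates. -/
def SMem (N M t : ℤ) (P : ℤ × ℤ) : Prop :=
  0 ≤ P.2 ∧ P.2 ≤ N * t * (N * P.1 - M * P.2)

/-- Normal form of the polynomial on lattice points. -/
def SForm (N M t : ℤ) (k : ℕ) (d f : ℝ) (F : ℤ × ℤ → ℝ) : Prop :=
  ∀ P : ℤ × ℤ, (N : ℝ) * F P = N * t / 2 * ((N * P.1 - M * P.2 : ℤ) : ℝ) ^ 2 +
    d * ((N * P.1 - M * P.2 : ℤ) : ℝ) + k * (P.2 : ℝ) + N * f

theorem SForm.step1 {N M t : ℤ} {k : ℕ} {d f : ℝ} {F : ℤ × ℤ → ℝ} (hN : 0 < N)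
    (h : SForm N M t k d f F) (x y : ℤ) : F (x + M, y + N) = F (x, y) + k := by
  have hN' : (N : ℝ) ≠ 0 := by exact_mod_cast hN.ne'
  have h1 := h (x + M, y + N)
  have h2 := h (x, y)
  apply mul_left_cancel₀ hN'
  rw [mul_add, h1, h2]
  push_cast
  ring

theorem SForm.step2 {N M t s : ℤ} {k : ℕ} {d f : ℝ} {F : ℤ × ℤ → ℝ} (hN : 0 < N)
    (hd : d = 1 - k * (N * t) / 2) (hs : (k : ℤ) = M + N * s)
    (h : SForm N M t k d f F) (x y c : ℤ) (hc : c = N * x - M * y) :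
    F (x + s + M - M * t * c, y + N - 1 - N * t * c) = F (x, y) + k := by
  have hN' : (N : ℝ) ≠ 0 := by exact_mod_cast hN.ne'
  have h1 := h (x + s + M - M * t * c, y + N - 1 - N * t * c)
  have h2 := h (x, y)
  apply mul_left_cancel₀ hN'
  have e1 : N * (x + s + M - M * t * c) - M * (y + N - 1 - N * t * c) = c + k := by
    rw [hs, hc]; ring
  rw [mul_add, h1, h2]
  dsimp only
  rw [e1, ← hc, hd]
  push_cast
  ring

/-- Predecessor lemma. -/
theorem smem_pred {N M t s : ℤ} {k : ℕ} {d f : ℝ} {F : ℤ × ℤ → ℝ} (hN : 0 < N)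
    (ht : 0 < t) (hco : IsCoprime N M)
    (hd : d = 1 - k * (N * t) / 2) (hs : (k : ℤ) = M + N * s)
    (h : SForm N M t k d f F) (x y c : ℤ) (hc : c = N * x - M * y)
    (hP : SMem N M t (x, y)) (hnot : ¬ (c < k ∧ y < N)) :
    ∃ x' y' c' : ℤ, c' = N * x' - M * y' ∧ SMem N M t (x', y') ∧ F (x, y) = F (x', y') + k ∧
      ((c' = c ∧ y' = y - N ∧ x' = x - M ∧ y' + N ≤ N * t * c') ∨
        (c' = c - k ∧ y' = y - N + 1 + N * t * c' ∧ x' = x - s - M + M * t * c' ∧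
          ¬ (y' + N ≤ N * t * c'))) := by
  obtain ⟨hy0, hyl⟩ := hP
  dsimp only at hy0 hyl
  rw [← hc] at hyl
  by_cases hy : N ≤ y
  · refine ⟨x - M, y - N, c, by rw [hc]; ring, ⟨by simp; omega, ?_⟩, ?_, Or.inl ⟨rfl, rfl, rfl, by omega⟩⟩
    · dsimp only
      have : N * (x - M) - M * (y - N) = c := by rw [hc]; ring
      rw [this]; omega
    · have := h.step1 hN (x - M) (y - N)
      simpa using this
  · push Not at hy
    have hck : (k : ℤ) ≤ c := by
      by_contra hlt; exact hnot ⟨by omega, hy⟩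
    have hc' : N * (x - s - M + M * t * (c - k)) - M * (y - N + 1 + N * t * (c - k)) = c - k := by
      rw [hs, hc]; ring
    have hNt : 0 < N * t := mul_pos hN ht
    have hm0 : 0 ≤ N * t * (c - k) := mul_nonneg hNt.le (by omega)
    have hge : 0 ≤ y - N + 1 + N * t * (c - k) := by
      rcases hck.lt_or_eq with hlt | heq
      · have : N ≤ N * t * (c - k) := by
          have h1 : 1 ≤ t * (c - k) := Int.add_one_le_iff.mpr (mul_pos ht (by omega))
          nlinarith
        omega
      · have hdv : N ∣ M * (y + 1) := ⟨x - s, by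
          have : M + N * s = N * x - M * y := by rw [← hs, ← hc, heq]
          linarith⟩
        have hdv2 := hco.dvd_of_dvd_mul_left hdv
        have := Int.le_of_dvd (by omega) hdv2
        have : 0 ≤ N * t * (c - k) := hm0
        omega
    refine ⟨_, _, c - k, hc'.symm, ⟨hge, ?_⟩, ?_, Or.inr ⟨rfl, rfl, rfl, by omega⟩⟩
    · dsimp only
      rw [hc']; omega
    · have := h.step2 hN hd hs _ _ (c - k) hc'.symm
      rw [← this]
      congr 1
      ext <;> dsimp only <;> ring

/-- Successor lemma. -/
theorem smem_succ {N M t s : ℤ} {k : ℕ} {d f : ℝ} {F : ℤ × ℤ → ℝ} (hN : 0 < N)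
    (ht : 0 < t) (hk : 1 ≤ k)
    (hd : d = 1 - k * (N * t) / 2) (hs : (k : ℤ) = M + N * s)
    (h : SForm N M t k d f F) (x y : ℤ)
    (hP : SMem N M t (x, y)) :
    ∃ Q, SMem N M t Q ∧ F Q = F (x, y) + k := by
  obtain ⟨c, hc⟩ : ∃ c, c = N * x - M * y := ⟨_, rfl⟩
  obtain ⟨hy0, hyl⟩ := hP
  dsimp only at hy0 hyl
  rw [← hc] at hyl
  by_cases hy : y + N ≤ N * t * c
  · refine ⟨_, ⟨?_, ?_⟩, h.step1 hN x y⟩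
    · dsimp only; omega
    · dsimp only
      have : N * (x + M) - M * (y + N) = c := by rw [hc]; ring
      rw [this]; omega
  · refine ⟨_, ⟨?_, ?_⟩, h.step2 hN hd hs x y c hc⟩
    · dsimp only; omega
    · dsimp only
      have e1 : N * (x + s + M - M * t * c) - M * (y + N - 1 - N * t * c) = c + k := by
        rw [hs, hc]; ring
      rw [e1]
      have hNt : 0 < N * t := mul_pos hN ht
      have hc0 : 0 ≤ c := by
        by_contra hneg
        have := mul_neg_of_pos_of_neg hNt (not_le.mp hneg)
        omega
      have h1 : 1 ≤ t * (c + k) := Int.add_one_le_iff.mpr (mul_pos ht (by omega))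
      have h2 : N ≤ N * t * (c + k) := by nlinarith
      omega

theorem smem_c_nonneg {N M t : ℤ} (hN : 0 < N) (ht : 0 < t) {x y : ℤ}
    (hP : SMem N M t (x, y)) : 0 ≤ N * x - M * y := by
  obtain ⟨hy0, hyl⟩ := hP
  dsimp only at hy0 hyl
  have hNt : 0 < N * t := mul_pos hN ht
  by_contra hneg
  have := mul_neg_of_pos_of_neg hNt (not_le.mp hneg)
  omega

theorem core_nat {N M t s : ℤ} {k : ℕ} {d f : ℝ} {F : ℤ × ℤ → ℝ} (hN : 0 < N)
    (ht : 0 < t) (hk : 1 ≤ k) (hco : IsCoprime N M)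
    (hd : d = 1 - k * (N * t) / 2) (hs : (k : ℤ) = M + N * s)
    (h : SForm N M t k d f F)
    (hA : ∀ x y : ℤ, SMem N M t (x, y) → N * x - M * y < k → y < N →
      ∃ j : ℕ, j < k ∧ F (x, y) = j)
    (x y : ℤ) (hP : SMem N M t (x, y)) : ∃ j : ℕ, F (x, y) = j := by
  have main : ∀ a b : ℕ, ∀ x y : ℤ, SMem N M t (x, y) → N * x - M * y = a → y = b →
      ∃ j : ℕ, F (x, y) = j := by
    intro a
    induction a using Nat.strong_induction_on with
    | _ a iha =>
    intro b
    induction b using Nat.strong_induction_on with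
    | _ b ihb =>
    intro x y hP hxa hyb
    by_cases hnot : N * x - M * y < k ∧ y < N
    · obtain ⟨j, _, hj⟩ := hA x y hP hnot.1 hnot.2
      exact ⟨j, hj⟩
    · obtain ⟨x', y', c', hc', hP', hF, hor⟩ :=
        smem_pred hN ht hco hd hs h x y _ rfl hP hnot
      have h0 := smem_c_nonneg hN ht hP'
      have h1 := hP'.1
      dsimp only at h1
      rw [← hc'] at h0
      have : ∃ j : ℕ, F (x', y') = j := by
        rcases hor with ⟨u, v, _⟩ | ⟨u, _⟩
        · exact ihb y'.toNat (by omega) x' y' hP' (by omega) (by omega)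
        · exact iha c'.toNat (by omega) y'.toNat x' y' hP' (by omega) (by omega)
      obtain ⟨j, hj⟩ := this
      exact ⟨j + k, by rw [hF, hj]; push_cast; ring⟩
  have h0 := smem_c_nonneg hN ht hP
  have h1 := hP.1
  dsimp only at h1
  exact main (N * x - M * y).toNat y.toNat x y hP (by omega) (by omega)

theorem core_inj {N M t s : ℤ} {k : ℕ} {d f : ℝ} {F : ℤ × ℤ → ℝ} (hN : 0 < N)
    (ht : 0 < t) (hk : 1 ≤ k) (hco : IsCoprime N M)
    (hd : d = 1 - k * (N * t) / 2) (hs : (k : ℤ) = M + N * s)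
    (h : SForm N M t k d f F)
    (hA : ∀ x y : ℤ, SMem N M t (x, y) → N * x - M * y < k → y < N →
      ∃ j : ℕ, j < k ∧ F (x, y) = j)
    (hinj : ∀ x y x' y' : ℤ, SMem N M t (x, y) → N * x - M * y < k → y < N →
      SMem N M t (x', y') → N * x' - M * y' < k → y' < N → F (x, y) = F (x', y') →
      (x, y) = (x', y'))
    (j : ℕ) : ∀ (x y x' y' : ℤ), SMem N M t (x, y) → SMem N M t (x', y') →
      F (x, y) = j → F (x', y') = j → (x, y) = (x', y') := by
  induction j using Nat.strong_induction_on with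
  | _ j ih =>
  have key : ∀ x y : ℤ, SMem N M t (x, y) → ¬ (N * x - M * y < k ∧ y < N) →
      F (x, y) = j → k ≤ j := by
    intro x y hP hnot hj
    obtain ⟨x', y', c', hc', hP', hF, -⟩ :=
      smem_pred hN ht hco hd hs h x y _ rfl hP hnot
    obtain ⟨i, hi⟩ := core_nat hN ht hk hco hd hs h hA x' y' hP'
    rw [hj, hi] at hF
    have : j = i + k := by exact_mod_cast hF
    omega
  have key2 : ∀ x y : ℤ, SMem N M t (x, y) → (N * x - M * y < k ∧ y < N) →
      F (x, y) = j → j < k := by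
    intro x y hP hnot hj
    obtain ⟨i, hi, hj'⟩ := hA x y hP hnot.1 hnot.2
    rw [hj] at hj'
    have : j = i := by exact_mod_cast hj'
    omega
  intro x y u v hP hQ h1 h2
  by_cases a1 : N * x - M * y < k ∧ y < N
  · by_cases a2 : N * u - M * v < k ∧ v < N
    · exact hinj x y u v hP a1.1 a1.2 hQ a2.1 a2.2 (h1.trans h2.symm)
    · have := key2 x y hP a1 h1
      have := key u v hQ a2 h2
      omega
  · by_cases a2 : N * u - M * v < k ∧ v < N
    · have := key2 u v hQ a2 h2
      have := key x y hP a1 h1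
      omega
    · have hkj := key x y hP a1 h1
      obtain ⟨x', y', c', hc', hP', hF, hor⟩ :=
        smem_pred hN ht hco hd hs h x y _ rfl hP a1
      obtain ⟨u', v', e', he', hQ', hG, hor'⟩ :=
        smem_pred hN ht hco hd hs h u v _ rfl hQ a2
      have hcast : ((j - k : ℕ) : ℝ) = j - k := by push_cast [hkj]; ring
      have := ih (j - k) (by omega) x' y' u' v' hP' hQ' (by rw [hcast]; linarith)
        (by rw [hcast]; linarith)
      simp only [Prod.mk.injEq] at this ⊢
      obtain ⟨rfl, rfl⟩ := this
      have hce : c' = e' := by rw [hc', he']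
      subst hce
      rcases hor with ⟨_, q1, q2, q3⟩ | ⟨_, q1, q2, q3⟩ <;>
      rcases hor' with ⟨_, r1, r2, r3⟩ | ⟨_, r1, r2, r3⟩
      · omega
      · exact absurd q3 r3
      · exact absurd r3 q3
      · omega

theorem core_surj {N M t s : ℤ} {k : ℕ} {d f : ℝ} {F : ℤ × ℤ → ℝ} (hN : 0 < N)
    (ht : 0 < t) (hk : 1 ≤ k)
    (hd : d = 1 - k * (N * t) / 2) (hs : (k : ℤ) = M + N * s)
    (h : SForm N M t k d f F)
    (hA : ∀ j : ℕ, j < k → ∃ P, SMem N M t P ∧ F P = j)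
    (j : ℕ) : ∃ P, SMem N M t P ∧ F P = j := by
  induction j using Nat.strong_induction_on with
  | _ j ih =>
  by_cases hj : j < k
  · exact hA j hj
  · obtain ⟨⟨x, y⟩, hP, hF⟩ := ih (j - k) (by omega)
    obtain ⟨Q, hQ, hFQ⟩ := smem_succ hN ht hk hd hs h x y hP
    refine ⟨Q, hQ, ?_⟩
    rw [hFQ, hF]
    push_cast [not_lt.mp hj]
    ring

/-- Asymptotics: the successor staircase is `c + k` for large `c`. -/
theorem asym (t k : ℤ) (ht : 1 ≤ t) (hk : 1 ≤ k) (a : ℝ) :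
    ∃ B : ℤ, ∀ c c' : ℤ, B ≤ c → 0 ≤ c' →
      |((c' : ℝ) - c) * (t * ((c' : ℝ) + c) / 2 + a) - k * t * c| ≤ k → c' = c + k := by
  have htR : (1 : ℝ) ≤ t := by exact_mod_cast ht
  have hkR : (1 : ℝ) ≤ k := by exact_mod_cast hk
  refine ⟨⌈((k : ℝ) + 1) * (t * (k + 1) + |a|) + k + 2 * |a| + 3⌉, ?_⟩
  intro c c' hB hc0 habs
  have hB' : ((k : ℝ) + 1) * (t * (k + 1) + |a|) + k + 2 * |a| + 3 ≤ c := Int.ceil_le.mp hB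
  have hc0' : (0 : ℝ) ≤ c' := by exact_mod_cast hc0
  obtain ⟨h1, h2⟩ := abs_le.mp habs
  have ha := abs_nonneg a
  have ha1 := le_abs_self a
  have ha2 := neg_abs_le a
  have hpos : 0 ≤ ((k : ℝ) + 1) * (t * (k + 1) + |a|) := by positivity
  have hcpos : (0 : ℝ) < c := by linarith
  have htc : (c : ℝ) ≤ t * c := by nlinarith
  have htc' : (0 : ℝ) ≤ t * c' := by positivity
  have hfac : 0 < (t : ℝ) * (c' + c) / 2 + a := by
    have : (t : ℝ) * (c' + c) = t * c' + t * c := by ring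
    rw [this]; linarith
  by_contra hne
  rcases lt_or_gt_of_ne hne with hlt | hgt
  · have hltR : (c' : ℝ) - c ≤ k - 1 := by
      have : c' ≤ c + k - 1 := by omega
      have : (c' : ℝ) ≤ c + k - 1 := by exact_mod_cast this
      linarith
    have s1 : ((c' : ℝ) - c) * (t * ((c' : ℝ) + c) / 2 + a) ≤
        (k - 1) * (t * ((c' : ℝ) + c) / 2 + a) := by
      apply mul_le_mul_of_nonneg_right hltR hfac.le
    have s2 : (t : ℝ) * ((c' : ℝ) + c) / 2 + a ≤ t * c + (t * (k + 1) + |a|) := by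
      have : (t : ℝ) * c' ≤ t * (c + (k + 1)) := by
        apply mul_le_mul_of_nonneg_left _ (by linarith)
        linarith
      have h3 : (0 : ℝ) ≤ t * (k + 1) := by positivity
      nlinarith
    have s3 : ((k : ℝ) - 1) * (t * ((c' : ℝ) + c) / 2 + a) ≤
        (k - 1) * (t * c + (t * (k + 1) + |a|)) :=
      mul_le_mul_of_nonneg_left s2 (by linarith)
    have s4 : ((k : ℝ) - 1) * (t * (k + 1) + |a|) ≤ (k + 1) * (t * (k + 1) + |a|) :=
      mul_le_mul_of_nonneg_right (by linarith) (by positivity)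
    nlinarith
  · have hgtR : (k : ℝ) + 1 ≤ c' - c := by
      have : c + k + 1 ≤ c' := by omega
      have : (c : ℝ) + k + 1 ≤ c' := by exact_mod_cast this
      linarith
    have s1 : ((k : ℝ) + 1) * (t * ((c' : ℝ) + c) / 2 + a) ≤
        ((c' : ℝ) - c) * (t * ((c' : ℝ) + c) / 2 + a) := by
      apply mul_le_mul_of_nonneg_right hgtR hfac.le
    have s2 : t * c - |a| ≤ (t : ℝ) * ((c' : ℝ) + c) / 2 + a := by
      have : (t : ℝ) * c ≤ t * c' := by
        apply mul_le_mul_of_nonneg_left _ (by linarith)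
        linarith
      nlinarith
    have s3 : ((k : ℝ) + 1) * (t * c - |a|) ≤ (k + 1) * (t * ((c' : ℝ) + c) / 2 + a) :=
      mul_le_mul_of_nonneg_left s2 (by linarith)
    have s4 : ((k : ℝ) + 1) * |a| ≤ (k + 1) * (t * (k + 1) + |a|) :=
      mul_le_mul_of_nonneg_left (by nlinarith) (by positivity)
    nlinarith

/-- Necessary conditions. -/
theorem core_nec {N M t : ℤ} {k : ℕ} {d f : ℝ} {F : ℤ × ℤ → ℝ} (hN : 0 < N) (hM : 0 < M)
    (ht : 0 < t) (hk : 1 ≤ k)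
    (h : SForm N M t k d f F)
    (p1 : ∀ P, SMem N M t P → ∃ j : ℕ, F P = j)
    (p2 : ∀ P Q, SMem N M t P → SMem N M t Q → F P = F Q → P = Q)
    (p3 : ∀ j : ℕ, ∃ P, SMem N M t P ∧ F P = j) :
    d = 1 - k * (N * t) / 2 ∧ ∃ s : ℤ, (k : ℤ) = M + N * s := by
  have hNR : (0 : ℝ) < N := by exact_mod_cast hN
  have hkR : (1 : ℝ) ≤ k := by exact_mod_cast hk
  obtain ⟨B, hB⟩ := asym t k ht (by exact_mod_cast hk) (d / N)
  -- the successor of the last stair of a large staircase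
  have key : ∀ x y c : ℤ, c = N * x - M * y → 0 ≤ y → y ≤ N * t * c → N * t * c < y + N →
      B ≤ c → ∃ x' y' : ℤ, c + k = N * x' - M * y' ∧ 0 ≤ y' ∧ y' < N ∧
        (y' : ℝ) = y + N - N * t * c - (N * t * k / 2 + d) := by
    intro x y c hc hy0 hyl hyu hBc
    have hP : SMem N M t (x, y) := ⟨hy0, by dsimp only; rw [← hc]; exact hyl⟩
    obtain ⟨j, hj⟩ := p1 _ hP
    obtain ⟨⟨x', y'⟩, hQ, hFQ⟩ := p3 (j + k)
    have hFF : F (x', y') = F (x, y) + k := by rw [hFQ, hj]; push_cast; ring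
    have hy'N : y' < N := by
      by_contra hge
      push Not at hge
      have hs1 := h.step1 hN (x' - M) (y' - N)
      simp only [sub_add_cancel] at hs1
      have hQ' : SMem N M t (x' - M, y' - N) := by
        refine ⟨by dsimp only; omega, ?_⟩
        dsimp only
        have : N * (x' - M) - M * (y' - N) = N * x' - M * y' := by ring
        rw [this]
        have := hQ.2
        dsimp only at this
        omega
      have heq := p2 _ _ hQ' hP (by linarith)
      simp only [Prod.mk.injEq] at heq
      have h2 := hQ.2
      dsimp only at h2
      have : N * x' - M * y' = c := by
        have e1 : x' = x + M := by omega
        have e2 : y' = y + N := by omega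
        rw [e1, e2, hc]; ring
      rw [this] at h2
      omega
    have hy'0 : 0 ≤ y' := hQ.1
    obtain ⟨c', hc'⟩ : ∃ c', c' = N * x' - M * y' := ⟨_, rfl⟩
    have hc'0 : 0 ≤ c' := by rw [hc']; exact smem_c_nonneg hN ht hQ
    have e1 := h (x', y')
    have e2 := h (x, y)
    dsimp only at e1 e2
    rw [← hc'] at e1
    rw [← hc] at e2
    rw [hFF, mul_add, e2] at e1
    have hyR0 : (0 : ℝ) ≤ y' := by exact_mod_cast hy'0
    have hyR1 : (y' : ℝ) ≤ N := by exact_mod_cast hy'N.le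
    have hyR2 : (y : ℝ) ≤ N * t * c := by exact_mod_cast hyl
    have hyR3 : (N * t * c : ℝ) ≤ y + N := by exact_mod_cast hyu.le
    have habs : |((c' : ℝ) - c) * (t * ((c' : ℝ) + c) / 2 + d / N) - (k : ℤ) * t * c| ≤ (k : ℤ) := by
      have e3 : ((c' : ℝ) - c) * (t * ((c' : ℝ) + c) / 2 + d / N) - (k : ℤ) * t * c
          = k * (y + N - N * t * c - y') / N := by
        push_cast
        field_simp
        linarith
      rw [e3, abs_le]
      push_cast
      constructor
      · rw [le_div_iff₀ hNR]; nlinarith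
      · rw [div_le_iff₀ hNR]; nlinarith
    have hcc := hB c c' hBc hc'0 habs
    refine ⟨x', y', by rw [← hc', hcc], hy'0, hy'N, ?_⟩
    rw [hcc] at e1
    push_cast at e1
    have hk0 : (k : ℝ) ≠ 0 := by positivity
    apply mul_left_cancel₀ hk0
    linarith
  obtain ⟨b, hbdef⟩ : ∃ b, b = |B| := ⟨_, rfl⟩
  have hb0 : 0 ≤ b := hbdef ▸ abs_nonneg B
  have hbB : B ≤ b := hbdef ▸ le_abs_self B
  have hNt : 0 < N * t := mul_pos hN ht
  obtain ⟨x1, y1, hc1, hy10, hy1N, hy1⟩ := key (b + M * t * N * b) (N * t * (N * b)) (N * b)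
    (by ring) (by positivity) le_rfl (by omega) (by nlinarith)
  obtain ⟨g, hg⟩ : ∃ g, g = N * (b + M + 1) - M := ⟨_, rfl⟩
  have hgb : b + 1 ≤ g := by rw [hg]; nlinarith
  have hNtg : N ≤ N * t * g := by
    have h1 : 1 ≤ t * g := Int.add_one_le_iff.mpr (mul_pos ht (by omega))
    nlinarith
  obtain ⟨x2, y2, hc2, hy20, hy2N, hy2⟩ := key (b + M + 1 + M * t * g - M) (N * t * g - N + 1) g
    (by linarith [hg]) (by omega) (by omega) (by omega) (by omega)
  push_cast at hy1 hy2
  have hsum : (y1 : ℝ) = y2 + N - 1 := by linarith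
  have hsumZ : y1 = y2 + N - 1 := by exact_mod_cast hsum
  have hy2z : y2 = 0 := by omega
  have hy1z : y1 = N - 1 := by omega
  refine ⟨?_, x1 - M - b, ?_⟩
  · rw [hy2z] at hy2
    push_cast at hy2
    linarith
  · rw [hy1z] at hc1
    linarith

theorem sector_iff {n m : ℤ} {N M t : ℤ} (hN : 0 < N) (hM : 0 < M) (ht : 0 < t)
    (hn : n = N * t * N) (hm : m = N * t * M + 1) (P : ℤ × ℤ) :
    P ∈ sectorLattice n m ↔ SMem N M t P := by
  obtain ⟨x, y⟩ := P
  subst hn hm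
  constructor
  · rintro ⟨_, h2, h3⟩
    refine ⟨h2, ?_⟩
    dsimp only at *
    linarith
  · intro h
    have hc := smem_c_nonneg hN ht h
    obtain ⟨h1, h2⟩ := h
    dsimp only at *
    refine ⟨?_, h1, ?_⟩
    · dsimp only
      have : 0 ≤ M * y := by positivity
      by_contra hneg
      have := mul_neg_of_pos_of_neg hN (not_le.mp hneg)
      omega
    · dsimp only
      linarith

theorem staircase_iff {n m : ℤ} {N M t : ℤ} (hN : 0 < N) (hM : 0 < M) (ht : 0 < t)
    (hn : n = N * t * N) (hm : m = N * t * M + 1) (hl : (Int.gcd n (m - 1) : ℤ) = N * t)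
    (c : ℕ) (P : ℤ × ℤ) :
    P ∈ staircase n m c ↔ SMem N M t P ∧ N * P.1 - M * P.2 = c := by
  have hNt : N * t ≠ 0 := (mul_pos hN ht).ne'
  unfold staircase
  rw [Set.mem_setOf_eq, sector_iff hN hM ht hn hm, hl]
  apply and_congr_right
  intro _
  rw [hn, hm]
  constructor
  · intro h
    apply mul_left_cancel₀ hNt
    linarith
  · intro h
    rw [← h]; ring

theorem asc_coeff {n m : ℤ} {N M t : ℤ} (hN : 0 < N) (hM : 0 < M) (ht : 0 < t)
    (hco : IsCoprime N M)
    (hn : n = N * t * N) (hm : m = N * t * M + 1) (hl : (Int.gcd n (m - 1) : ℤ) = N * t)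
    {k : ℕ} {p : ℝ → ℝ → ℝ} (hp : IsAscendingKStair n m k p) :
    p ((1 + M : ℤ) : ℝ) (N : ℝ) - p ((1 : ℤ) : ℝ) ((0 : ℤ) : ℝ) = k := by
  have h1t : 1 ≤ t := ht
  refine hp.2 (1, 0) (1 + M, N) ⟨N.toNat, ?_, ?_, ?_, ?_⟩ ?_
  · rw [staircase_iff hN hM ht hn hm hl]
    refine ⟨⟨le_rfl, ?_⟩, ?_⟩
    · dsimp only; rw [mul_zero, sub_zero]; positivity
    · dsimp only; omega
  · rw [staircase_iff hN hM ht hn hm hl]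
    have e : N * (1 + M) - M * N = N := by ring
    refine ⟨⟨hN.le, ?_⟩, ?_⟩
    · dsimp only; rw [e]
      have : 1 ≤ t * N := Int.add_one_le_iff.mpr (mul_pos ht hN)
      nlinarith
    · dsimp only; rw [e]; omega
  · intro h
    simp only [Prod.mk.injEq] at h
    omega
  · rintro ⟨x, y⟩ hxy
    rw [staircase_iff hN hM ht hn hm hl] at hxy
    have h2 := hxy.2
    dsimp only at h2 ⊢
    rw [Int.toNat_of_nonneg hN.le] at h2
    have hd : N ∣ M * y := ⟨x - 1, by linarith⟩
    obtain ⟨w, rfl⟩ := hco.dvd_of_dvd_mul_left hd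
    have hx : x = 1 + M * w := by
      apply mul_left_cancel₀ hN.ne'
      linarith
    rw [min_eq_left (by omega), max_eq_right (by omega), hx]
    rintro ⟨h3, h4⟩
    have h5 : 0 < w := by
      by_contra hw
      have := mul_nonpos_of_nonneg_of_nonpos hM.le (not_lt.mp hw)
      omega
    have : M ≤ M * w := by nlinarith
    omega
  · dsimp only
    nlinarith

theorem sform_of_asc {n m : ℤ} {N M t : ℤ} (hN : 0 < N) (hM : 0 < M) (ht : 0 < t)
    (hco : IsCoprime N M)
    (hn : n = N * t * N) (hm : m = N * t * M + 1) (hl : (Int.gcd n (m - 1) : ℤ) = N * t)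
    {k : ℕ} {p : ℝ → ℝ → ℝ} (hp : IsAscendingKStair n m k p) (d e f : ℝ)
    (hq : ∀ x y : ℝ,
      p x y = (n : ℝ) / 2 * (x - ((m : ℝ) - 1) / (n : ℝ) * y) ^ 2 + d * x + e * y + f) :
    d * M + e * N = k ∧ SForm N M t k d f (fun P => p P.1 P.2) := by
  have hNR : (N : ℝ) ≠ 0 := by exact_mod_cast hN.ne'
  have htR : (t : ℝ) ≠ 0 := by exact_mod_cast ht.ne'
  have hr : ((m : ℝ) - 1) / (n : ℝ) = M / N := by
    rw [hn, hm]; push_cast; field_simp; ring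
  have h1 := asc_coeff hN hM ht hco hn hm hl hp
  rw [hq, hq, hr] at h1
  have hk : d * M + e * N = k := by
    rw [← h1]; push_cast; field_simp; ring
  refine ⟨hk, ?_⟩
  rintro ⟨x, y⟩
  dsimp only
  rw [hq, hr, ← hk, hn]
  push_cast
  field_simp
  ring

theorem first_lt {n m : ℤ} {N M t : ℤ} (hN : 0 < N) (hM : 0 < M) (ht : 0 < t)
    (hn : n = N * t * N) (hm : m = N * t * M + 1) (hl : (Int.gcd n (m - 1) : ℤ) = N * t)
    {c : ℕ} {P : ℤ × ℤ} (h : IsFirstStair n m c P) : P.2 < N := by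
  obtain ⟨x, y⟩ := P
  obtain ⟨h1, h2⟩ := h
  rw [staircase_iff hN hM ht hn hm hl] at h1
  obtain ⟨⟨h3, h4⟩, h5⟩ := h1
  dsimp only at *
  by_contra hge
  have e : N * (x - M) - M * (y - N) = N * x - M * y := by ring
  have := h2 (x - M, y - N) (by
    rw [staircase_iff hN hM ht hn hm hl]
    refine ⟨⟨?_, ?_⟩, ?_⟩
    · dsimp only; omega
    · dsimp only; rw [e]; omega
    · dsimp only; rw [e, h5])
  dsimp only at this
  omega

theorem stair_unique {N M : ℤ} (hN : 0 < N) (hco : IsCoprime N M) {P Q : ℤ × ℤ}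
    (h : N * P.1 - M * P.2 = N * Q.1 - M * Q.2) (h1 : 0 ≤ P.2) (h2 : P.2 < N)
    (h3 : 0 ≤ Q.2) (h4 : Q.2 < N) : P = Q := by
  have hd : N ∣ M * (P.2 - Q.2) := ⟨P.1 - Q.1, by linarith⟩
  have hd2 := hco.dvd_of_dvd_mul_left hd
  have hy : P.2 - Q.2 = 0 := Int.eq_zero_of_abs_lt_dvd hd2 (by rw [abs_lt]; omega)
  have hy' : P.2 = Q.2 := by omega
  ext
  · rw [hy'] at h
    apply mul_left_cancel₀ hN.ne'
    linarith
  · exact hy'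

theorem reduce (n M0 : ℕ) (hn : 0 < n) (hM : 0 < M0) (hdvd : n ∣ M0 ^ 2) :
    ∃ N M t : ℕ, 0 < N ∧ 0 < M ∧ 0 < t ∧ Nat.Coprime N M ∧ n = N * t * N ∧ M0 = N * t * M ∧
      Nat.gcd n M0 = N * t := by
  obtain ⟨N, M, hco, h1, h2⟩ := Nat.exists_coprime n M0
  have hl : 0 < Nat.gcd n M0 := Nat.gcd_pos_of_pos_left _ hn
  generalize Nat.gcd n M0 = l at *
  have hNl : N ∣ l := by
    rw [h1, h2] at hdvd
    have : (M * l) ^ 2 = (l * M ^ 2) * l := by ring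
    rw [this] at hdvd
    exact (hco.pow_right 2).dvd_of_dvd_mul_right (Nat.dvd_of_mul_dvd_mul_right hl hdvd)
  obtain ⟨t, rfl⟩ := hNl
  refine ⟨N, M, t, ?_, ?_, ?_, hco, ?_, ?_, rfl⟩
  · rcases Nat.eq_zero_or_pos N with h | h
    · simp [h] at hl
    · exact h
  · rcases Nat.eq_zero_or_pos M with h | h
    · simp [h] at h2; omega
    · exact h
  · rcases Nat.eq_zero_or_pos t with h | h
    · simp [h] at hl
    · exact h
  · rw [h1]; ring
  · rw [h2]; ring

/-- Let `a_1, …, a_k` be the first stairs on the staircases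
`S_0, …, S_{k−1}` of `S(n/m)`. A quadratic polynomial `p` (with the required quadratic
part) is an ascending packing polynomial on `S(n/m)` if and only if `p` is an ascending
`k`-stair polynomial of the necessary form with `k ≡ (m−1)/l (mod n/l)` and
`{p(a_1), …, p(a_k)} = {0, 1, …, k−1}`. -/
theorem sufficient_condition (n m : ℕ) (hn : 0 < n) (hm : 2 ≤ m)
    (hco : Nat.Coprime n m) (hdvd : n ∣ (m - 1) ^ 2) (k : ℕ) (hk : 1 ≤ k)
    (A : ℕ → ℤ × ℤ) (hA : ∀ i < k, IsFirstStair (n : ℤ) (m : ℤ) i (A i))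
    (p : ℝ → ℝ → ℝ) (hquad : HasQuadPart (n : ℤ) (m : ℤ) p) :
    (IsAscendingKStair (n : ℤ) (m : ℤ) k p ∧
        IsPackingPolyOn p (sectorLattice (n : ℤ) (m : ℤ))) ↔
    (IsAscendingKStair (n : ℤ) (m : ℤ) k p ∧
      (k : ℤ) ≡ ((m : ℤ) - 1) / (Nat.gcd n (m - 1) : ℤ)
        [ZMOD (n : ℤ) / (Nat.gcd n (m - 1) : ℤ)] ∧
      (∃ f : ℝ, ∀ x y : ℝ, p x y =
        (n : ℝ) / 2 * (x - ((m : ℝ) - 1) / (n : ℝ) * y) ^ 2 +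
          (1 - (k : ℝ) * (Nat.gcd n (m - 1) : ℝ) / 2) * x +
          ((2 * (1 - (m : ℝ)) + (k : ℝ) * (Nat.gcd n (m - 1) : ℝ) * ((m : ℝ) + 1)) /
            (2 * (n : ℝ))) * y + f) ∧
      (fun i : ℕ => p ((A i).1 : ℝ) ((A i).2 : ℝ)) '' (Set.Iio k) =
        (fun j : ℕ => (j : ℝ)) '' (Set.Iio k)) := by
  obtain ⟨M0, rfl⟩ : ∃ M0, m = M0 + 1 := ⟨m - 1, by omega⟩
  have hmm : M0 + 1 - 1 = M0 := rfl
  rw [hmm] at hdvd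
  rw [hmm]
  obtain ⟨N', M', t', hN0, hM0, ht0, hcop, en, eM, eg⟩ := reduce n M0 hn (by omega) hdvd
  rw [eg]
  obtain ⟨N, hNe⟩ : ∃ N : ℤ, N = N' := ⟨_, rfl⟩
  obtain ⟨M, hMe⟩ : ∃ M : ℤ, M = M' := ⟨_, rfl⟩
  obtain ⟨t, hte⟩ : ∃ t : ℤ, t = t' := ⟨_, rfl⟩
  have hN : 0 < N := by omega
  have hM : 0 < M := by omega
  have ht : 0 < t := by omega
  have hNco : IsCoprime N M := by rw [hNe, hMe]; exact Nat.isCoprime_iff_coprime.mpr hcop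
  have zn : (n : ℤ) = N * t * N := by rw [en, hNe, hte]; push_cast; ring
  have zm : ((M0 + 1 : ℕ) : ℤ) = N * t * M + 1 := by rw [eM, hNe, hte, hMe]; push_cast; ring
  have hl : (Int.gcd (n : ℤ) (((M0 + 1 : ℕ) : ℤ) - 1) : ℤ) = N * t := by
    have : ((M0 + 1 : ℕ) : ℤ) - 1 = (M0 : ℤ) := by push_cast; ring
    rw [this, Int.gcd_natCast_natCast, eg, hNe, hte]; push_cast; ring
  have hNR : (N : ℝ) ≠ 0 := by exact_mod_cast hN.ne'
  have htR : (t : ℝ) ≠ 0 := by exact_mod_cast ht.ne'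
  have rl : ((N' * t' : ℕ) : ℝ) = N * t := by rw [hNe, hte]; push_cast; ring
  have zl : ((N' * t' : ℕ) : ℤ) = N * t := by rw [hNe, hte]; push_cast; ring
  have rn : (n : ℝ) = N * t * N := by exact_mod_cast congrArg (Int.cast (R := ℝ)) zn
  have rm : ((M0 + 1 : ℕ) : ℝ) = N * t * M + 1 := by
    exact_mod_cast congrArg (Int.cast (R := ℝ)) zm
  have hsec := sector_iff hN hM ht zn zm
  have hst := staircase_iff hN hM ht zn zm hl
  have hAm : ∀ i < k, SMem N M t (A i) ∧ N * (A i).1 - M * (A i).2 = i ∧ (A i).2 < N := by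
    intro i hi
    have h1 := (hst i (A i)).mp (hA i hi).1
    exact ⟨h1.1, h1.2, first_lt hN hM ht zn zm hl (hA i hi)⟩
  have hAeq : ∀ x y : ℤ, SMem N M t (x, y) → N * x - M * y < k → y < N →
      ∃ i < k, (x, y) = A i ∧ N * x - M * y = i := by
    intro x y hP hc hy
    have h0 := smem_c_nonneg hN ht hP
    have hi : (N * x - M * y).toNat < k := by omega
    refine ⟨(N * x - M * y).toNat, hi, ?_, by omega⟩
    obtain ⟨a1, a2, a3⟩ := hAm _ hi
    refine stair_unique hN hNco ?_ hP.1 hy a1.1 a3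
    rw [a2]; dsimp only; omega
  have zdiv1 : (((M0 + 1 : ℕ) : ℤ) - 1) / ((N' * t' : ℕ) : ℤ) = M := by
    rw [zm, zl, add_sub_cancel_right]
    exact Int.mul_ediv_cancel_left _ (mul_pos hN ht).ne'
  have zdiv2 : (n : ℤ) / ((N' * t' : ℕ) : ℤ) = N := by
    rw [zn, zl]
    exact Int.mul_ediv_cancel_left _ (mul_pos hN ht).ne'
  rw [zdiv1, zdiv2]
  obtain ⟨d, e, f, hq⟩ := hquad
  constructor
  · rintro ⟨hasc, hp1, hp2, hp3⟩
    obtain ⟨hk', hF⟩ := sform_of_asc hN hM ht hNco zn zm hl hasc d e f hq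
    obtain ⟨hd, s, hs⟩ := core_nec hN hM ht hk hF
      (fun P hP => hp1 P ((hsec P).mpr hP))
      (fun P Q hP hQ h => hp2 ((hsec P).mpr hP) ((hsec Q).mpr hQ) h)
      (fun j => by
        obtain ⟨P, hP, h⟩ := hp3 j
        exact ⟨P, (hsec P).mp hP, h⟩)
    refine ⟨hasc, ?_, ⟨f, ?_⟩, ?_⟩
    · rw [hs]
      exact (Int.modEq_iff_dvd.mpr ⟨-s, by ring⟩)
    · intro x y
      rw [hq]
      have he : e = (2 * (1 - ((M0 + 1 : ℕ) : ℝ)) + k * ((N' * t' : ℕ) : ℝ) *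
          (((M0 + 1 : ℕ) : ℝ) + 1)) / (2 * n) := by
        have : e = (k - d * M) / N := by field_simp; linarith
        rw [this, hd, rl, rm, rn]
        field_simp
        ring
      rw [← he, rl, hd]
      push_cast
      ring
    · have hsub : (fun j : ℕ => (j : ℝ)) '' (Set.Iio k) ⊆
          (fun i : ℕ => p ((A i).1 : ℝ) ((A i).2 : ℝ)) '' (Set.Iio k) := by
        rintro _ ⟨j, hj, rfl⟩
        obtain ⟨⟨x, y⟩, hP, hv⟩ := hp3 j
        rw [hsec] at hP
        by_cases hc : N * x - M * y < k ∧ y < N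
        · obtain ⟨i, hi, hAi, -⟩ := hAeq x y hP hc.1 hc.2
          refine ⟨i, hi, ?_⟩
          dsimp only
          rw [← hAi]; exact hv
        · exfalso
          obtain ⟨x', y', c', -, hP', hFe, -⟩ :=
            smem_pred hN ht hNco hd hs hF x y _ rfl hP hc
          obtain ⟨i, hi⟩ := hp1 _ ((hsec _).mpr hP')
          dsimp only at hFe hi hv
          rw [hv, hi] at hFe
          have : j = i + k := by exact_mod_cast hFe
          have : j < k := hj
          omega
      symm
      refine Set.eq_of_subset_of_ncard_le hsub ?_ ((Set.finite_Iio k).image _)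
      rw [Set.ncard_image_of_injective _ Nat.cast_injective]
      exact Set.ncard_image_le (Set.finite_Iio k)
  · rintro ⟨hasc, hmod, ⟨f', hf'⟩, himg⟩
    obtain ⟨-, hF⟩ := sform_of_asc hN hM ht hNco zn zm hl hasc _ _ f' hf'
    obtain ⟨s, hs⟩ : ∃ s, (k : ℤ) = M + N * s := by
      obtain ⟨w, hw⟩ := Int.modEq_iff_dvd.mp hmod
      exact ⟨-w, by linarith⟩
    have hd : 1 - (k : ℝ) * ((N' * t' : ℕ) : ℝ) / 2 = 1 - k * (N * t) / 2 := by rw [rl]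
    have hA1 : ∀ x y : ℤ, SMem N M t (x, y) → N * x - M * y < k → y < N →
        ∃ j : ℕ, j < k ∧ p x y = j := by
      intro x y hP h1 h2
      obtain ⟨i, hi, hAi, -⟩ := hAeq x y hP h1 h2
      have : p ((A i).1 : ℝ) ((A i).2 : ℝ) ∈ (fun j : ℕ => (j : ℝ)) '' (Set.Iio k) := by
        rw [← himg]; exact ⟨i, hi, rfl⟩
      obtain ⟨j, hj, hv⟩ := this
      refine ⟨j, hj, ?_⟩
      rw [← hAi] at hv
      exact hv.symm
    have hinjA : Set.InjOn (fun i : ℕ => p ((A i).1 : ℝ) ((A i).2 : ℝ)) (Set.Iio k) := by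
      apply Set.injOn_of_ncard_image_eq _ (Set.finite_Iio k)
      rw [himg, Set.ncard_image_of_injective _ Nat.cast_injective]
    have hA2 : ∀ x y x' y' : ℤ, SMem N M t (x, y) → N * x - M * y < k → y < N →
        SMem N M t (x', y') → N * x' - M * y' < k → y' < N → p x y = p x' y' →
        (x, y) = (x', y') := by
      intro x y x' y' hP h1 h2 hQ h3 h4 hv
      obtain ⟨i, hi, hAi, -⟩ := hAeq x y hP h1 h2
      obtain ⟨j, hj, hAj, -⟩ := hAeq x' y' hQ h3 h4
      have : i = j := hinjA hi hj (by dsimp only; rw [← hAi, ← hAj]; exact hv)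
      rw [hAi, hAj, this]
    have hA3 : ∀ j : ℕ, j < k → ∃ P, SMem N M t P ∧ p (P.1 : ℝ) (P.2 : ℝ) = j := by
      intro j hj
      have : (j : ℝ) ∈ (fun i : ℕ => p ((A i).1 : ℝ) ((A i).2 : ℝ)) '' (Set.Iio k) := by
        rw [himg]; exact ⟨j, hj, rfl⟩
      obtain ⟨i, hi, hv⟩ := this
      exact ⟨A i, (hAm i hi).1, hv⟩
    refine ⟨hasc, ?_, ?_, ?_⟩
    · rintro ⟨x, y⟩ hP
      exact core_nat hN ht hk hNco hd hs hF hA1 x y ((hsec _).mp hP)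
    · rintro ⟨x, y⟩ hP ⟨x', y'⟩ hQ hv
      obtain ⟨j, hj⟩ := core_nat hN ht hk hNco hd hs hF hA1 x y ((hsec _).mp hP)
      exact core_inj hN ht hk hNco hd hs hF hA1 hA2 j x y x' y' ((hsec _).mp hP)
        ((hsec _).mp hQ) hj (hv.symm.trans hj)
    · intro j
      obtain ⟨P, hP, hv⟩ := core_surj hN ht hk hd hs hF hA3 j
      exact ⟨P, (hsec P).mpr hP, hv⟩
end
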